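/- There is an absolute constant C with the following property. Let k ∈ ℂ⁺ and let f ∈ C_c^∞(ℝ³ ∖ {0}; ℂ³) be a smooth vector field whose compact support avoids the origin. For r > 0 and σ ∈ S² define μ₄(r,σ) := −r ∫_{ℝ³} ∇_y( e^{ik(−r+|rσ−y|+|y|)} / (4π |rσ−y|) ) · f(y) dy. Then sup_{r>0} ‖μ₄(r,·)‖_{L²(S²)} ≤ C [ ( 1/|k|² + 1/(Im k)² + |k|/(Im k)^{3/2} + |k|/(Im k)² + 1/(Im k) )^{1/2} + ( 1/|k|² + 1/(|k|² (Im k)²) + 1/(|k| (Im k)^{1/2}) + 1/(|k| (Im k)²) )^{1/2} ] ‖f‖_{2,w}. -/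

import Mathlib

open MeasureTheory Metric

noncomputable section

/-- The kernel `e^{ik(−r+|rσ−y|+|y|)} / (4π |rσ−y|)`. -/
def ker4 (k : ℂ) (r : ℝ) (σ y : EuclideanSpace ℝ (Fin 3)) : ℂ :=
  Complex.exp (Complex.I * k * ((-r + ‖r • σ - y‖ + ‖y‖ : ℝ) : ℂ)) /
    ((4 * Real.pi * ‖r • σ - y‖ : ℝ) : ℂ)

/-- The weight `w(x) = 1` for `|x| > 1` and `w(x) = |x|⁻²` for `|x| ≤ 1`. -/
def wt (x : EuclideanSpace ℝ (Fin 3)) : ℝ := if 1 < ‖x‖ then 1 else (‖x‖ ^ 2)⁻¹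

/-- `μ₄(r,σ) = −r ∫ ∇_y(ker4(k,r,σ,y)) · f(y) dy`. -/
def mu4 (k : ℂ) (f : EuclideanSpace ℝ (Fin 3) → EuclideanSpace ℂ (Fin 3))
    (r : ℝ) (σ : EuclideanSpace ℝ (Fin 3)) : ℂ :=
  -(r : ℂ) * ∫ y : EuclideanSpace ℝ (Fin 3), ∑ i : Fin 3,
    fderiv ℝ (fun z => ker4 k r σ z) y (EuclideanSpace.single i 1) * f y i

end

/-- Euclidean three-space. -/
abbrev E3 := EuclideanSpace ℝ (Fin 3)

/-- The surface measure on the unit sphere coming from Lebesgue measure. -/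
noncomputable abbrev SS : Measure (sphere (0 : E3) 1) := (volume : Measure E3).toSphere

/-- Standard basis vectors. -/
noncomputable abbrev eb (i : Fin 3) : E3 := EuclideanSpace.single i 1

lemma polar {G : Type*} [NormedAddCommGroup G] [NormedSpace ℝ G] [CompleteSpace G]
    (F : E3 → G) (hF : Integrable F) :
    ∫ x, F x = ∫ r in Set.Ioi (0 : ℝ), (r ^ 2 : ℝ) • ∫ σ, F (r • (σ : E3)) ∂SS := by
  have hdim : Module.finrank ℝ E3 = 3 := by simp
  have hmp := (volume : Measure E3).measurePreserving_homeomorphUnitSphereProd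
  rw [hdim] at hmp
  set F2 : sphere (0 : E3) 1 × Set.Ioi (0 : ℝ) → G := fun z => F ((z.2 : ℝ) • (z.1 : E3)) with hF2
  have key : ∀ x : ({(0 : E3)}ᶜ : Set E3), F2 (homeomorphUnitSphereProd E3 x) = F x := by
    intro x
    have hx : ‖(x : E3)‖ ≠ 0 := by
      exact norm_ne_zero_iff.mpr x.2
    simp only [hF2, homeomorphUnitSphereProd_apply_snd_coe, homeomorphUnitSphereProd_apply_fst_coe]
    rw [smul_smul, mul_inv_cancel₀ hx, one_smul]
  have hIntg : Integrable F2 (SS.prod (Measure.volumeIoiPow 2)) := by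
    have := hmp.integrable_comp_emb (g := F2) (Homeomorph.measurableEmbedding _)
    rw [← this]
    have h2 : (F2 ∘ (homeomorphUnitSphereProd E3)) = F ∘ (Subtype.val : ({(0 : E3)}ᶜ : Set E3) → E3) := by
      funext x; exact key x
    rw [h2, ← integrableOn_iff_comap_subtypeVal (by measurability)]
    exact hF.integrableOn
  calc
    ∫ x, F x = ∫ x : ({(0)}ᶜ : Set E3), F x.1 ∂((volume : Measure E3).comap (↑)) := by
      rw [integral_subtype_comap (measurableSet_singleton _).compl F,
        restrict_compl_singleton]
    _ = ∫ z, F2 z ∂(SS.prod (Measure.volumeIoiPow 2)) := by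
      rw [← hmp.integral_comp (Homeomorph.measurableEmbedding _) F2]
      exact integral_congr_ae (Filter.Eventually.of_forall fun x => (key x).symm)
    _ = ∫ r, ∫ σ, F2 (σ, r) ∂SS ∂(Measure.volumeIoiPow 2) := integral_prod_symm _ hIntg
    _ = _ := by
      simp only [Measure.volumeIoiPow, ENNReal.ofReal, hF2]
      rw [integral_withDensity_eq_integral_smul,
        integral_subtype_comap measurableSet_Ioi
          fun a : ℝ ↦ Real.toNNReal (a ^ 2) • ∫ σ, F (a • (σ : E3)) ∂SS,
        setIntegral_congr_fun measurableSet_Ioi fun x hx ↦ ?_]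
      · rw [NNReal.smul_def, Real.coe_toNNReal _ (pow_nonneg hx.out.le _)]
      · exact (measurable_subtype_coe.pow_const _).real_toNNReal

lemma continuous_sph {G : Type*} [NormedAddCommGroup G] [NormedSpace ℝ G] [CompleteSpace G]
    {H : ℝ → E3 → G} (hc : Continuous (fun z : ℝ × E3 => H z.1 z.2)) :
    Continuous (fun r => ∫ σ, H r (σ : E3) ∂SS) := by
  have := continuous_parametric_integral_of_continuous (μ := SS)
    (f := fun (r : ℝ) (σ : sphere (0 : E3) 1) => H r (σ : E3))
    (by
      have : Continuous (fun z : ℝ × sphere (0 : E3) 1 => ((z.1, (z.2 : E3)) : ℝ × E3)) := by fun_prop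
      exact hc.comp this) (s := Set.univ) isCompact_univ
  simpa using this

lemma integrable_sph {G : Type*} [NormedAddCommGroup G]
    {H : E3 → G} (hc : Continuous H) : Integrable (fun σ : sphere (0 : E3) 1 => H σ) SS :=
  Continuous.integrable_of_hasCompactSupport (by fun_prop) (HasCompactSupport.of_compactSpace _)

lemma hasDerivAt_sph {G : Type*} [NormedAddCommGroup G] [NormedSpace ℝ G] [CompleteSpace G]
    {H H' : ℝ → E3 → G} (hc : Continuous (fun z : ℝ × E3 => H z.1 z.2))
    (hc' : Continuous (fun z : ℝ × E3 => H' z.1 z.2))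
    (hd : ∀ r (σ : E3), HasDerivAt (fun r => H r σ) (H' r σ) r) (r : ℝ) :
    HasDerivAt (fun r => ∫ σ, H r (σ : E3) ∂SS) (∫ σ, H' r (σ : E3) ∂SS) r := by
  have hK : IsCompact (Set.Icc (r - 1) (r + 1) ×ˢ sphere (0 : E3) 1) :=
    isCompact_Icc.prod (isCompact_sphere _ _)
  obtain ⟨C, hC⟩ := hK.exists_bound_of_continuousOn hc'.continuousOn
  refine (hasDerivAt_integral_of_dominated_loc_of_deriv_le (s := Set.Icc (r - 1) (r + 1))
    (bound := fun _ => C) (F := fun r (σ : sphere (0 : E3) 1) => H r σ)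
    (F' := fun r (σ : sphere (0 : E3) 1) => H' r σ)
    (Icc_mem_nhds (by linarith) (by linarith)) ?_ ?_ ?_ ?_ ?_ ?_).2
  · refine Filter.Eventually.of_forall fun r => ?_
    exact (integrable_sph (H := fun x => H r x) (by fun_prop)).aestronglyMeasurable
  · exact (integrable_sph (H := fun x => H r x) (by fun_prop))
  · exact (integrable_sph (H := fun x => H' r x) (by fun_prop)).aestronglyMeasurable
  · exact Filter.Eventually.of_forall fun σ x hx => hC (x, σ) ⟨hx, σ.2⟩
  · exact integrable_const _
  · exact Filter.Eventually.of_forall fun σ x hx => hd x σ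

lemma hasFDerivAt_norm3 {x : E3} (hx : x ≠ 0) :
    HasFDerivAt (fun y : E3 => ‖y‖) (‖x‖⁻¹ • innerSL ℝ x) x := by
  have h1 : HasFDerivAt (fun y : E3 => ‖y‖ ^ 2) (2 • (innerSL ℝ x)) x :=
    (hasStrictFDerivAt_norm_sq x).hasFDerivAt
  have hn : ‖x‖ ≠ 0 := norm_ne_zero_iff.mpr hx
  have h2 := h1.sqrt (pow_ne_zero 2 hn)
  have h3 : (fun y : E3 => Real.sqrt (‖y‖ ^ 2)) = fun y => ‖y‖ := by
    funext y; exact Real.sqrt_sq (norm_nonneg y)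
  rw [h3] at h2
  have h4 : (1 / (2 * Real.sqrt (‖x‖ ^ 2))) • 2 • (innerSL ℝ) x = ‖x‖⁻¹ • innerSL ℝ x := by
    rw [Real.sqrt_sq (norm_nonneg x), ← Nat.cast_smul_eq_nsmul ℝ, smul_smul]
    congr 1
    push_cast
    field_simp
  rw [h4] at h2
  exact h2

lemma inner_eb (x : E3) (i : Fin 3) : inner ℝ x (eb i) = x i := by
  simp [eb, EuclideanSpace.inner_single_right]

lemma radial_hasFDerivAt {χ : ℝ → ℝ} (hχ : ContDiff ℝ 1 χ)
    (hs : tsupport χ ⊆ Set.Ioi 0) (x : E3) :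
    HasFDerivAt (fun y : E3 => (χ ‖y‖ : ℂ))
      (Complex.ofRealCLM.comp ((deriv χ ‖x‖ * ‖x‖⁻¹) • innerSL ℝ x)) x := by
  refine Complex.ofRealCLM.hasFDerivAt.comp x ?_
  by_cases hx : x = 0
  · subst hx
    have h0 : (0 : ℝ) ∉ tsupport χ := fun h => lt_irrefl (0 : ℝ) (Set.mem_Ioi.mp (hs h))
    have hev : ∀ᶠ t in nhds (0 : ℝ), χ t = 0 := by
      have := (isClosed_tsupport χ).isOpen_compl.mem_nhds h0
      filter_upwards [this] with t ht
      exact image_eq_zero_of_notMem_tsupport ht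
    have hev2 : ∀ᶠ y in nhds (0 : E3), χ ‖y‖ = 0 := by
      have : Filter.Tendsto (fun y : E3 => ‖y‖) (nhds 0) (nhds 0) := by
        simpa using (continuous_norm (E := E3)).tendsto 0
      exact this.eventually hev
    have : HasFDerivAt (fun y : E3 => (0 : ℝ)) (0 : E3 →L[ℝ] ℝ) 0 := hasFDerivAt_const _ _
    have hz : (deriv χ ‖(0 : E3)‖ * ‖(0 : E3)‖⁻¹) • innerSL ℝ (0 : E3) = 0 := by
      rw [norm_zero, inv_zero, mul_zero, zero_smul]
    rw [hz]
    exact this.congr_of_eventuallyEq hev2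
  · have h1 := (hχ.differentiable (by norm_num)).differentiableAt (x := ‖x‖) |>.hasDerivAt
    have := h1.comp_hasFDerivAt x (hasFDerivAt_norm3 hx)
    rw [smul_smul] at this
    exact this

lemma radial_compact {χ : ℝ → ℝ} (hχ : HasCompactSupport χ) :
    HasCompactSupport (fun y : E3 => (χ ‖y‖ : ℂ)) := by
  obtain ⟨R, hR⟩ := hχ.isCompact.isBounded.subset_closedBall 0
  refine HasCompactSupport.intro (isCompact_closedBall (0 : E3) R) ?_
  intro x hx
  have : ‖x‖ ∉ tsupport χ := by
    intro h
    have := hR h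
    simp at this hx
    linarith
  simp [image_eq_zero_of_notMem_tsupport this]

/-- Divergence of a complex vector field given by its components. -/
noncomputable def dv (V : Fin 3 → E3 → ℂ) (x : E3) : ℂ := ∑ i, fderiv ℝ (V i) x (eb i)

lemma continuous_dv {V : Fin 3 → E3 → ℂ} (hV : ∀ i, ContDiff ℝ 1 (V i)) : Continuous (dv V) := by
  unfold dv
  refine continuous_finsetSum _ fun i _ => ?_
  exact ((hV i).continuous_fderiv (by norm_num)).clm_apply continuous_const

lemma radial_div {V : Fin 3 → E3 → ℂ} (hV : ∀ i, ContDiff ℝ 1 (V i)) {χ : ℝ → ℝ}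
    (hχ : ContDiff ℝ 1 χ) (hc : HasCompactSupport χ)
    (hs : tsupport χ ⊆ Set.Ioi 0) :
    ∫ x : E3, (χ ‖x‖ : ℂ) * dv V x =
      - ∫ x : E3, ((deriv χ ‖x‖ * ‖x‖⁻¹ : ℝ) : ℂ) * ∑ i, V i x * x i := by
  set ψ : E3 → ℂ := fun y => (χ ‖y‖ : ℂ) with hψ
  have hψd := fun x => radial_hasFDerivAt hχ hs x
  have hψc : HasCompactSupport ψ := radial_compact hc
  have hψcont : Continuous ψ := by
    have := hχ.continuous
    fun_prop
  have hfd : ∀ x i, fderiv ℝ ψ x (eb i) = ((deriv χ ‖x‖ * ‖x‖⁻¹ : ℝ) : ℂ) * x i := by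
    intro x i
    rw [(hψd x).fderiv]
    simp [inner_eb]
  have hψdc : ∀ i, Continuous (fun x => fderiv ℝ ψ x (eb i)) := by
    intro i
    rw [continuous_iff_continuousAt]
    intro x
    by_cases hx : x = 0
    · subst hx
      have h0 : (0 : ℝ) ∉ tsupport χ := fun h => lt_irrefl (0 : ℝ) (Set.mem_Ioi.mp (hs h))
      have hev : ∀ᶠ t in nhds (0 : ℝ), deriv χ t = 0 := by
        have := (isClosed_tsupport χ).isOpen_compl.mem_nhds h0
        filter_upwards [this] with t ht
        by_contra h
        exact ht (support_deriv_subset h)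
      have hev2 : ∀ᶠ y in nhds (0 : E3), deriv χ ‖y‖ = 0 := by
        have : Filter.Tendsto (fun y : E3 => ‖y‖) (nhds 0) (nhds 0) := by
          simpa using (continuous_norm (E := E3)).tendsto 0
        exact this.eventually hev
      have : (fun x => fderiv ℝ ψ x (eb i)) =ᶠ[nhds 0] fun _ => (0 : ℂ) := by
        filter_upwards [hev2] with y hy
        rw [hfd, hy]; simp
      exact (continuousAt_const.congr this.symm)
    · simp_rw [hfd]
      have h1 : ContinuousAt (fun y : E3 => ‖y‖⁻¹) x :=
        (continuous_norm.continuousAt).inv₀ (norm_ne_zero_iff.mpr hx)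
      have h2 : Continuous (deriv χ) := hχ.continuous_deriv (by norm_num)
      have h3 : ContinuousAt (fun y : E3 => deriv χ ‖y‖) x := by fun_prop
      have h4 : ContinuousAt (fun y : E3 => ((deriv χ ‖y‖ * ‖y‖⁻¹ : ℝ) : ℂ)) x :=
        Complex.continuous_ofReal.continuousAt.comp (h3.mul h1)
      refine h4.mul ?_
      fun_prop
  have hψdcs : ∀ i, HasCompactSupport (fun x => fderiv ℝ ψ x (eb i)) := fun i =>
    hψc.fderiv_apply ℝ _
  have hI1 : ∀ i, Integrable (fun x => ψ x * fderiv ℝ (V i) x (eb i)) := by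
    intro i
    refine Continuous.integrable_of_hasCompactSupport ?_ hψc.mul_right
    exact hψcont.mul (((hV i).continuous_fderiv (by norm_num)).clm_apply continuous_const)
  have hI2 : ∀ i, Integrable (fun x => fderiv ℝ ψ x (eb i) * V i x) := by
    intro i
    refine Continuous.integrable_of_hasCompactSupport ?_ (hψdcs i).mul_right
    exact (hψdc i).mul (hV i).continuous
  have hI3 : ∀ i, Integrable (fun x => ψ x * V i x) := by
    intro i
    exact Continuous.integrable_of_hasCompactSupport (hψcont.mul (hV i).continuous) hψc.mul_right
  calc ∫ x : E3, ψ x * dv V x = ∑ i, ∫ x, ψ x * fderiv ℝ (V i) x (eb i) := by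
        rw [← integral_finsetSum _ fun i _ => hI1 i]
        simp [dv, Finset.mul_sum]
    _ = ∑ i, - ∫ x, fderiv ℝ ψ x (eb i) * V i x := by
        refine Finset.sum_congr rfl fun i _ => ?_
        exact integral_mul_fderiv_eq_neg_fderiv_mul_of_integrable (hI2 i) (hI1 i) (hI3 i)
          (fun x _ => (hψd x).differentiableAt)
          (fun x _ => (hV i).differentiable (by norm_num) x)
    _ = _ := by
        rw [Finset.sum_neg_distrib, ← integral_finsetSum _ fun i _ => hI2 i]
        congr 2
        funext x
        rw [Finset.mul_sum]
        refine Finset.sum_congr rfl fun i _ => ?_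
        rw [hfd]; ring

/-- Flux of `V` through the sphere of radius `r`. -/
noncomputable def flux (V : Fin 3 → E3 → ℂ) (r : ℝ) : ℂ :=
  ∫ σ, (r : ℂ) ^ 2 * ∑ i, V i (r • (σ : E3)) * ((σ : E3) i : ℂ) ∂SS

lemma flux_hasDerivAt {V : Fin 3 → E3 → ℂ} (hV : ∀ i, ContDiff ℝ 1 (V i)) {r : ℝ} (hr : 0 < r) :
    HasDerivAt (flux V) ((r : ℂ) ^ 2 * ∫ σ, dv V (r • (σ : E3)) ∂SS) r := by
  set H : ℝ → E3 → ℂ := fun r σ => (r : ℂ) ^ 2 * ∑ i, V i (r • σ) * (σ i : ℂ) with hH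
  set H' : ℝ → E3 → ℂ := fun r σ => (2 * (r : ℂ)) * ∑ i, V i (r • σ) * (σ i : ℂ) +
    (r : ℂ) ^ 2 * ∑ i, fderiv ℝ (V i) (r • σ) σ * (σ i : ℂ) with hH'
  have hVc := fun i => (hV i).continuous
  have hVf := fun i => (hV i).continuous_fderiv (by norm_num)
  have hHc : Continuous (fun z : ℝ × E3 => H z.1 z.2) := by
    simp only [hH]; fun_prop
  have hHc' : Continuous (fun z : ℝ × E3 => H' z.1 z.2) := by
    simp only [hH']; fun_prop
  have hd : ∀ r (σ : E3), HasDerivAt (fun r => H r σ) (H' r σ) r := by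
    intro r σ
    have h1 : HasDerivAt (fun r : ℝ => (r : ℂ) ^ 2) (2 * (r : ℂ)) r := by
      have := ((hasDerivAt_id r).ofReal_comp).fun_pow 2
      simpa using this
    have h2 : ∀ i, HasDerivAt (fun r : ℝ => V i (r • σ) * (σ i : ℂ))
        (fderiv ℝ (V i) (r • σ) σ * (σ i : ℂ)) r := by
      intro i
      refine HasDerivAt.mul_const ?_ _
      have h3 : HasDerivAt (fun r : ℝ => r • σ) σ r := by
        simpa using (hasDerivAt_id r).smul_const σ
      exact ((hV i).differentiable (by norm_num) (r • σ)).hasFDerivAt.comp_hasDerivAt r h3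
    exact h1.mul (HasDerivAt.fun_sum fun i _ => h2 i)
  have hder := fun r => hasDerivAt_sph hHc hHc' hd r
  set P : ℝ → ℂ := flux V with hP
  set P' : ℝ → ℂ := fun r => ∫ σ, H' r (σ : E3) ∂SS with hP'
  have hPder : ∀ r, HasDerivAt P (P' r) r := hder
  have hPc : Continuous P := continuous_sph hHc
  have hPc' : Continuous P' := continuous_sph hHc'
  set Q : ℝ → ℂ := fun r => (r : ℂ) ^ 2 * ∫ σ, dv V (r • (σ : E3)) ∂SS with hQ
  have hdvc := continuous_dv hV
  have hQc : Continuous Q := by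
    have : Continuous (fun r : ℝ => ∫ σ, dv V (r • (σ : E3)) ∂SS) :=
      continuous_sph (H := fun r x => dv V (r • x)) (by fun_prop)
    simp only [hQ]; fun_prop
  have key : ∀ᵐ x ∂(volume : Measure ℝ), x ∈ Set.Ioi (0 : ℝ) → (P' - Q) x = 0 := by
    refine isOpen_Ioi.ae_eq_zero_of_integral_contDiff_smul_eq_zero ?_ ?_
    · exact (hPc'.sub hQc).locallyIntegrable.locallyIntegrableOn _
    · intro χ hχ hχc hχs
      have hχ1 : ContDiff ℝ 1 χ := hχ.of_le (by exact_mod_cast le_top)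
      have hχcont := hχ.continuous
      have hχd : Continuous (deriv χ) := hχ1.continuous_deriv (by norm_num)
      have hχ0 : ∀ x, x ∉ Set.Ioi (0 : ℝ) → χ x = 0 := fun x hx =>
        image_eq_zero_of_notMem_tsupport fun h => hx (hχs h)
      have hχd0 : ∀ x, x ∉ Set.Ioi (0 : ℝ) → deriv χ x = 0 := fun x hx => by
        by_contra h
        exact hx (hχs (support_deriv_subset h))
      have e1 : ∫ x, χ x • Q x = ∫ x : E3, (χ ‖x‖ : ℂ) * dv V x := by
        rw [polar]
        · rw [← setIntegral_eq_integral_of_forall_compl_eq_zero (s := Set.Ioi (0 : ℝ))]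
          · refine setIntegral_congr_fun measurableSet_Ioi fun r hr => ?_
            have hr' : |r| = r := abs_of_pos hr
            have : ∀ σ : sphere (0 : E3) 1, ‖r • (σ : E3)‖ = r := by
              intro σ; rw [norm_smul]; simp [hr']
            simp only [this, hQ]
            rw [integral_const_mul]
            simp only [Complex.real_smul]
            push_cast
            ring
          · intro x hx; simp [hχ0 x hx]
        · refine Continuous.integrable_of_hasCompactSupport (by fun_prop) ?_
          exact (radial_compact hχc).mul_right
      have e2 : ∫ x, ((deriv χ x : ℝ) : ℂ) * P x =
          ∫ x : E3, ((deriv χ ‖x‖ * ‖x‖⁻¹ : ℝ) : ℂ) * ∑ i, V i x * x i := by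
        rw [polar]
        · rw [← setIntegral_eq_integral_of_forall_compl_eq_zero (s := Set.Ioi (0 : ℝ))]
          · refine setIntegral_congr_fun measurableSet_Ioi fun r hr => ?_
            have hr0 : 0 < r := hr
            have hr' : |r| = r := abs_of_pos hr
            have : ∀ σ : sphere (0 : E3) 1, ‖r • (σ : E3)‖ = r := by
              intro σ; rw [norm_smul]; simp [hr']
            simp only [this, hP, flux]
            rw [← integral_const_mul, ← integral_smul]
            refine integral_congr_ae (Filter.Eventually.of_forall fun σ => ?_)
            simp only [Complex.real_smul, PiLp.smul_apply, smul_eq_mul, Finset.mul_sum]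
            refine Finset.sum_congr rfl fun i _ => ?_
            have : (r : ℂ) ≠ 0 := by exact_mod_cast hr0.ne'
            push_cast
            field_simp
          · intro x hx; simp [hχd0 x hx]
        · have hcs : HasCompactSupport (fun x : E3 => ((deriv χ ‖x‖ * ‖x‖⁻¹ : ℝ) : ℂ)) :=
            radial_compact (χ := fun t => deriv χ t * t⁻¹) (hχc.deriv.mul_right)
          refine Continuous.integrable_of_hasCompactSupport ?_ hcs.mul_right
          have hc1 : Continuous (fun t : ℝ => deriv χ t * t⁻¹) := by
            rw [continuous_iff_continuousAt]
            intro t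
            by_cases ht : t ∈ tsupport χ
            · have : t ≠ 0 := (hχs ht).ne'
              exact hχd.continuousAt.mul (continuousAt_inv₀ this)
            · have : (fun t : ℝ => deriv χ t * t⁻¹) =ᶠ[nhds t] fun _ => (0 : ℝ) := by
                filter_upwards [(isClosed_tsupport χ).isOpen_compl.mem_nhds ht] with y hy
                have : deriv χ y = 0 := by
                  by_contra h
                  exact hy (support_deriv_subset h)
                simp [this]
              exact continuousAt_const.congr this.symm
          have hc2 : Continuous (fun x : E3 => (deriv χ ‖x‖ * ‖x‖⁻¹ : ℝ)) :=
            hc1.comp continuous_norm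
          fun_prop
      have e3 : ∫ x, (χ x : ℂ) * P' x = - ∫ x, ((deriv χ x : ℝ) : ℂ) * P x := by
        have hcs1 : HasCompactSupport (fun x => (χ x : ℂ)) := hχc.comp_left (g := fun t : ℝ => (t : ℂ)) (by simp)
        have hcs2 : HasCompactSupport (fun x => ((deriv χ x : ℝ) : ℂ)) :=
          hχc.deriv.comp_left (g := fun t : ℝ => (t : ℂ)) (by simp)
        refine integral_mul_deriv_eq_deriv_mul_of_integrable
          (u := fun x => (χ x : ℂ)) (u' := fun x => ((deriv χ x : ℝ) : ℂ)) (fun x _ => ?_) (fun x _ => hPder x)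
          ?_ ?_ ?_
        · exact ((hχ1.differentiable (by norm_num)) x).hasDerivAt.ofReal_comp
        · exact Continuous.integrable_of_hasCompactSupport (by fun_prop) hcs1.mul_right
        · exact Continuous.integrable_of_hasCompactSupport (by fun_prop) hcs2.mul_right
        · exact Continuous.integrable_of_hasCompactSupport (by fun_prop) hcs1.mul_right
      have e4 := radial_div hV hχ1 hχc hχs
      simp only [Pi.sub_apply, smul_sub]
      rw [integral_sub, e1, e4, ← e2]
      · simp only [Complex.real_smul]
        rw [e3]; ring
      · exact Continuous.integrable_of_hasCompactSupport (by fun_prop) hχc.smul_right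
      · exact Continuous.integrable_of_hasCompactSupport (by fun_prop) hχc.smul_right
  have key2 : P' r = Q r := by
    have h1 : P' =ᵐ[volume.restrict (Set.Ioi (0 : ℝ))] Q := by
      rw [Filter.EventuallyEq, ae_restrict_iff' measurableSet_Ioi]
      filter_upwards [key] with x hx hx0
      exact sub_eq_zero.mp (hx hx0)
    exact (Measure.eqOn_open_of_ae_eq h1 isOpen_Ioi hPc'.continuousOn hQc.continuousOn) hr
  have := hPder r
  rw [key2] at this
  exact this

/-- The outgoing Helmholtz kernel. -/
noncomputable def gk (k : ℂ) (z : E3) : ℂ :=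
  Complex.exp (Complex.I * k * (‖z‖ : ℝ)) / ((4 * Real.pi * ‖z‖ : ℝ) : ℂ)

/-- Its gradient. -/
noncomputable def gk' (k : ℂ) (i : Fin 3) (z : E3) : ℂ :=
  Complex.exp (Complex.I * k * (‖z‖ : ℝ)) / ((4 * Real.pi * ‖z‖ : ℝ) : ℂ) *
    (Complex.I * k - (‖z‖ : ℂ)⁻¹) * ((z i : ℂ) * (‖z‖ : ℂ)⁻¹)

lemma norm_exp_le {k : ℂ} (hk : 0 < k.im) {t : ℝ} (ht : 0 ≤ t) :
    ‖Complex.exp (Complex.I * k * (t : ℝ))‖ ≤ 1 := by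
  rw [Complex.norm_exp]
  have : (Complex.I * k * (t : ℝ)).re = - (k.im * t) := by simp
  rw [this]
  exact Real.exp_le_one_iff.mpr (by nlinarith [mul_nonneg hk.le ht])

lemma norm_gk_le {k : ℂ} (hk : 0 < k.im) (z : E3) : ‖gk k z‖ ≤ ‖z‖⁻¹ := by
  unfold gk
  rw [norm_div]
  have h1 := norm_exp_le hk (norm_nonneg z)
  have h2 : ‖((4 * Real.pi * ‖z‖ : ℝ) : ℂ)‖ = 4 * Real.pi * ‖z‖ := by
    rw [Complex.norm_real, Real.norm_of_nonneg]
    positivity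
  rw [h2]
  by_cases hz : ‖z‖ = 0
  · simp [hz]
  have hz0 : 0 < ‖z‖ := lt_of_le_of_ne (norm_nonneg z) (Ne.symm hz)
  have hpi := Real.pi_gt_three
  rw [div_le_iff₀ (by positivity)]
  have : ‖z‖⁻¹ * (4 * Real.pi * ‖z‖) = 4 * Real.pi := by field_simp
  rw [this]; linarith

lemma norm_gk'_le {k : ℂ} (hk : 0 < k.im) (i : Fin 3) (z : E3) :
    ‖gk' k i z‖ ≤ ‖k‖ * ‖z‖⁻¹ + (‖z‖ ^ 2)⁻¹ := by
  have h1 := norm_gk_le hk z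
  have h2 : gk' k i z = gk k z * (Complex.I * k - (‖z‖ : ℂ)⁻¹) * ((z i : ℂ) * (‖z‖ : ℂ)⁻¹) := rfl
  have h3 : ‖Complex.I * k - (‖z‖ : ℂ)⁻¹‖ ≤ ‖k‖ + ‖z‖⁻¹ := by
    refine (norm_sub_le _ _).trans ?_
    simp
  have h4 : ‖(z i : ℂ) * (‖z‖ : ℂ)⁻¹‖ ≤ 1 := by
    rw [norm_mul, norm_inv, Complex.norm_real, Complex.norm_real, norm_norm]
    have := PiLp.norm_apply_le z i
    by_cases hz : ‖z‖ = 0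
    · simp [hz]
    have hz0 : 0 < ‖z‖ := lt_of_le_of_ne (norm_nonneg z) (Ne.symm hz)
    rw [← div_eq_mul_inv]
    exact div_le_one_of_le₀ this hz0.le
  rw [h2, norm_mul, norm_mul]
  calc _ ≤ ‖z‖⁻¹ * (‖k‖ + ‖z‖⁻¹) * 1 := by gcongr
    _ = _ := by ring

lemma measurable_gk (k : ℂ) : Measurable (gk k) := by
  unfold gk; fun_prop

lemma measurable_gk' (k : ℂ) (i : Fin 3) : Measurable (gk' k i) := by
  unfold gk'
  have : Measurable (fun z : E3 => (z i : ℂ)) := by fun_prop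
  fun_prop

lemma locInt_of_bound {h : E3 → ℂ} (hm : Measurable h) {C : ℝ}
    (hb : ∀ z, ‖h z‖ ≤ C * ‖z‖⁻¹ + (‖z‖ ^ 2)⁻¹) : LocallyIntegrable h := by
  rw [locallyIntegrable_iff]
  intro K hK
  obtain ⟨R, hR⟩ := hK.isBounded.subset_ball 0
  refine IntegrableOn.mono_set ?_ hR
  have hdim : Module.finrank ℝ E3 = 3 := by simp
  have h1 : IntegrableOn (fun x : E3 => (fun t : ℝ => C * t⁻¹ + (t ^ 2)⁻¹) ‖x‖) (ball (0 : E3) R) := by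
    refine (integrableOn_fun_norm_addHaar (volume : Measure E3)
      (f := fun t : ℝ => C * t⁻¹ + (t ^ 2)⁻¹)).2 ?_
    rw [hdim]
    have : IntegrableOn (fun y : ℝ => C * y + 1) (Set.Ioo 0 R) := by
      refine IntegrableOn.mono_set ?_ Set.Ioo_subset_Icc_self
      exact Continuous.integrableOn_Icc (by fun_prop)
    refine this.congr_fun (fun y hy => ?_) measurableSet_Ioo
    have : y ≠ 0 := hy.1.ne'
    simp
    field_simp
  refine Integrable.mono' h1 hm.aestronglyMeasurable.restrict ?_
  exact Filter.Eventually.of_forall fun z => hb z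

lemma locInt_gk {k : ℂ} (hk : 0 < k.im) : LocallyIntegrable (gk k) := by
  refine locInt_of_bound (measurable_gk k) (C := 1) fun z => (norm_gk_le hk z).trans ?_
  have : 0 ≤ (‖z‖ ^ 2)⁻¹ := by positivity
  linarith

lemma locInt_gk' {k : ℂ} (hk : 0 < k.im) (i : Fin 3) : LocallyIntegrable (gk' k i) :=
  locInt_of_bound (measurable_gk' k i) (norm_gk'_le hk i)

lemma int_mul {h φ : E3 → ℂ} (hh : LocallyIntegrable h) (hφ : Continuous φ)
    (hc : HasCompactSupport φ) : Integrable (fun z => h z * φ z) := by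
  have := hh.integrable_smul_left_of_hasCompactSupport hφ hc
  refine this.congr (Filter.Eventually.of_forall fun z => ?_)
  simp [mul_comm]

lemma int_Ioi {Z Z' : ℝ → ℂ} (hZ : Continuous Z) (hZ' : Continuous Z')
    (hd : ∀ r, 0 < r → HasDerivAt Z (Z' r) r) {R : ℝ} (h0 : ∀ r, R < r → Z r = 0)
    (h0' : ∀ r, R < r → Z' r = 0) : ∫ r in Set.Ioi (0 : ℝ), Z' r = - Z 0 := by
  have hi : IntegrableOn Z' (Set.Ioi 0) := by
    have h1 : IntegrableOn Z' (Set.Icc 0 (max R 0)) := hZ'.integrableOn_Icc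
    have h2 : IntegrableOn Z' (Set.Ioi (max R 0)) :=
      integrableOn_zero.congr_fun (fun r hr => (h0' r ((le_max_left _ _).trans_lt hr)).symm)
        measurableSet_Ioi
    refine (h1.union h2).mono_set ?_
    intro r hr
    rcases le_or_gt r (max R 0) with h | h
    · exact Or.inl ⟨le_of_lt hr, h⟩
    · exact Or.inr h
  have ht : Filter.Tendsto Z Filter.atTop (nhds 0) := by
    refine tendsto_const_nhds.congr' ?_
    filter_upwards [Filter.eventually_gt_atTop R] with r hr
    exact (h0 r hr).symm
  rw [integral_Ioi_of_hasDerivAt_of_tendsto hZ.continuousWithinAt (fun r hr => hd r hr) hi ht]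
  simp

lemma exp_hasDerivAt (k : ℂ) (r : ℝ) :
    HasDerivAt (fun r : ℝ => Complex.exp (Complex.I * k * (r : ℝ)))
      (Complex.I * k * Complex.exp (Complex.I * k * (r : ℝ))) r := by
  have h1 : HasDerivAt (fun r : ℝ => Complex.I * k * (r : ℝ)) (Complex.I * k) r := by
    simpa using ((hasDerivAt_id r).ofReal_comp).const_mul (Complex.I * k)
  have := h1.cexp
  rwa [mul_comm (Complex.exp _)] at this

lemma norm_sph {r : ℝ} (hr : 0 < r) (σ : sphere (0 : E3) 1) : ‖r • (σ : E3)‖ = r := by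
  rw [norm_smul]; simp [abs_of_pos hr]

lemma exists_radius {φ : E3 → ℂ} (hc : HasCompactSupport φ) :
    ∃ R : ℝ, 0 < R ∧ ∀ x, R < ‖x‖ → x ∉ tsupport φ := by
  obtain ⟨R, hR⟩ := hc.isCompact.isBounded.subset_closedBall 0
  refine ⟨max R 1, by positivity, fun x hx h => ?_⟩
  have := hR h
  simp at this
  have := le_max_left R 1
  linarith

lemma tsupport_dv {V : Fin 3 → E3 → ℂ} {x : E3} (h : ∀ i, x ∉ tsupport (V i)) : dv V x = 0 := by
  unfold dv
  refine Finset.sum_eq_zero fun i _ => ?_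
  have : fderiv ℝ (V i) x = 0 := by
    by_contra hh
    exact h i (support_fderiv_subset ℝ hh)
  simp [this]

lemma hasCompactSupport_dv {V : Fin 3 → E3 → ℂ} (hVs : ∀ i, HasCompactSupport (V i)) :
    HasCompactSupport (dv V) := by
  choose R hR0 hR using fun i => exists_radius (hVs i)
  refine HasCompactSupport.intro (isCompact_closedBall (0 : E3) (∑ i, R i)) ?_
  intro x hx
  refine tsupport_dv fun i => hR i x ?_
  simp only [mem_closedBall, dist_zero_right, not_le] at hx
  refine lt_of_le_of_lt ?_ hx
  exact Finset.single_le_sum (fun j _ => (hR0 j).le) (Finset.mem_univ i)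

/-- Integration by parts against the kernel. -/
lemma gk_ibp {k : ℂ} (hk : 0 < k.im) {V : Fin 3 → E3 → ℂ} (hV : ∀ i, ContDiff ℝ 1 (V i))
    (hVs : ∀ i, HasCompactSupport (V i)) :
    ∫ z, ∑ i, gk' k i z * V i z = - ∫ z, gk k z * dv V z := by
  have hVc := fun i => (hV i).continuous
  have hdvc := continuous_dv hV
  have hI1 : Integrable (fun z => ∑ i, gk' k i z * V i z) :=
    integrable_finsetSum _ fun i _ => int_mul (locInt_gk' hk i) (hVc i) (hVs i)
  have hI2 : Integrable (fun z => gk k z * dv V z) :=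
    int_mul (locInt_gk hk) hdvc (hasCompactSupport_dv hVs)
  have hI12 : Integrable (fun z => ∑ i, gk' k i z * V i z + gk k z * dv V z) := hI1.add hI2
  rw [eq_neg_iff_add_eq_zero, ← integral_add hI1 hI2, polar _ hI12]
  choose R hR0 hR using fun i => exists_radius (hVs i)
  have hRs : ∀ i, R i ≤ ∑ i, R i := fun i =>
    Finset.single_le_sum (fun j _ => (hR0 j).le) (Finset.mem_univ i)
  set A : ℝ → ℂ := fun r => ∫ σ, ∑ i, V i (r • (σ : E3)) * ((σ : E3) i : ℂ) ∂SS with hA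
  set B : ℝ → ℂ := fun r => ∫ σ, dv V (r • (σ : E3)) ∂SS with hB
  have hAc : Continuous A := continuous_sph (H := fun r x => ∑ i, V i (r • x) * (x i : ℂ)) (by fun_prop)
  have hBc : Continuous B := continuous_sph (H := fun r x => dv V (r • x)) (by fun_prop)
  have hfl : ∀ r, flux V r = (r : ℂ) ^ 2 * A r := fun r => by
    simp only [flux, hA]; rw [integral_const_mul]
  have hpi : ((4 * Real.pi : ℝ) : ℂ) ≠ 0 := by
    have := Real.pi_pos
    exact_mod_cast (by positivity : (4 * Real.pi : ℝ) ≠ 0)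
  set Z : ℝ → ℂ := fun r => Complex.exp (Complex.I * k * (r : ℝ)) * (r * A r) / ((4 * Real.pi : ℝ) : ℂ)
    with hZ
  set Z' : ℝ → ℂ := fun r => Complex.exp (Complex.I * k * (r : ℝ)) *
    (Complex.I * k * r * A r - A r + r * B r) / ((4 * Real.pi : ℝ) : ℂ) with hZ'
  have e : ∀ r ∈ Set.Ioi (0 : ℝ), (r ^ 2 : ℝ) • ∫ σ : sphere (0 : E3) 1,
      (∑ i, gk' k i (r • (σ : E3)) * V i (r • (σ : E3)) + gk k (r • (σ : E3)) * dv V (r • (σ : E3))) ∂SS = Z' r := by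
    intro r hr
    have hr0 : (r : ℂ) ≠ 0 := by exact_mod_cast (ne_of_gt hr)
    have h1 : ∀ σ : sphere (0 : E3) 1,
        (∑ i, gk' k i (r • (σ : E3)) * V i (r • (σ : E3)) + gk k (r • (σ : E3)) * dv V (r • (σ : E3))) =
        (Complex.exp (Complex.I * k * (r : ℝ)) / ((4 * Real.pi * r : ℝ) : ℂ) * (Complex.I * k - (r : ℂ)⁻¹)) *
          (∑ i, V i (r • (σ : E3)) * ((σ : E3) i : ℂ)) +
        (Complex.exp (Complex.I * k * (r : ℝ)) / ((4 * Real.pi * r : ℝ) : ℂ)) * dv V (r • (σ : E3)) := by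
      intro σ
      simp only [gk, gk', norm_sph hr σ, Finset.mul_sum]
      congr 1
      refine Finset.sum_congr rfl fun i _ => ?_
      simp only [PiLp.smul_apply, smul_eq_mul]
      push_cast
      field_simp
    simp_rw [h1]
    rw [integral_add, integral_const_mul, integral_const_mul]
    · simp only [hZ', Complex.real_smul]
      push_cast at hpi ⊢
      change (r : ℂ) ^ 2 * (_ * A r + _ * B r) = _
      have hpi' : (Real.pi : ℂ) ≠ 0 := by exact_mod_cast Real.pi_ne_zero
      field_simp
    · exact (integrable_sph (H := fun x => ∑ i, V i (r • x) * (x i : ℂ)) (by fun_prop)).const_mul _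
    · exact (integrable_sph (H := fun x => dv V (r • x)) (by fun_prop)).const_mul _
  rw [setIntegral_congr_fun measurableSet_Ioi e]
  have hfar : ∀ r, ∑ i, R i < r → A r = 0 ∧ B r = 0 := by
    intro r hr
    have hr0 : 0 < r := lt_of_le_of_lt (Finset.sum_nonneg fun i _ => (hR0 i).le) hr
    have hn : ∀ (σ : sphere (0 : E3) 1) i, r • (σ : E3) ∉ tsupport (V i) := fun σ i =>
      hR i _ (by rw [norm_sph hr0]; exact (hRs i).trans_lt hr)
    constructor
    · simp only [hA]
      rw [integral_congr_ae (g := fun _ => 0) (Filter.Eventually.of_forall fun σ => ?_)]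
      · simp
      · exact Finset.sum_eq_zero fun i _ => by simp [image_eq_zero_of_notMem_tsupport (hn σ i)]
    · simp only [hB]
      rw [integral_congr_ae (g := fun _ => 0) (Filter.Eventually.of_forall fun σ => ?_)]
      · simp
      · exact tsupport_dv (hn σ)
  rw [int_Ioi (Z := Z) (Z' := Z') (by fun_prop) (by fun_prop) ?_ (R := ∑ i, R i)
    (fun r hr => by simp [hZ, (hfar r hr).1]) (fun r hr => by simp [hZ', (hfar r hr).1, (hfar r hr).2])]
  · simp [hZ]
  · intro r hr
    have hr0 : (r : ℂ) ≠ 0 := by exact_mod_cast (ne_of_gt hr)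
    have h1 := flux_hasDerivAt hV hr
    have h2 := h1.div ((hasDerivAt_id r).ofReal_comp) (by simpa using hr0)
    have h3 : HasDerivAt (fun r : ℝ => (r : ℂ) * A r) (r * B r - A r) r := by
      have h4 : HasDerivAt (fun r : ℝ => flux V r / (r : ℂ)) (r * B r - A r) r := by
        refine h2.congr_deriv ?_
        simp only [hfl, hB, id]
        push_cast
        field_simp
      refine h4.congr_of_eventuallyEq ?_
      filter_upwards [lt_mem_nhds hr] with t ht
      have ht0 : (t : ℂ) ≠ 0 := by exact_mod_cast (ne_of_gt ht)
      rw [hfl]; field_simp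
    have h5 := ((exp_hasDerivAt k r).mul h3).div_const ((4 * Real.pi : ℝ) : ℂ)
    refine h5.congr_deriv ?_
    simp only [hZ']
    ring

/-- The normalising constant. -/
noncomputable def cS : ℝ := SS.real Set.univ / (4 * Real.pi)

lemma gk_fund {k : ℂ} (hk : 0 < k.im) {φ : E3 → ℂ} (hφ : ContDiff ℝ 2 φ)
    (hs : HasCompactSupport φ) :
    ∫ z, gk k z * (dv (fun i x => fderiv ℝ φ x (eb i)) z + k ^ 2 * φ z) = - (cS : ℂ) * φ 0 := by
  set V : Fin 3 → E3 → ℂ := fun i x => fderiv ℝ φ x (eb i) with hVdef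
  have hV : ∀ i, ContDiff ℝ 1 (V i) := fun i =>
    (hφ.fderiv_right (m := 1) (by norm_num)).clm_apply contDiff_const
  have hVs : ∀ i, HasCompactSupport (V i) := fun i => hs.fderiv_apply ℝ _
  have hVc := fun i => (hV i).continuous
  have hdvc := continuous_dv hV
  have hφc := hφ.continuous
  have hI : Integrable (fun z => gk k z * (dv V z + k ^ 2 * φ z)) := by
    refine int_mul (locInt_gk hk) (by fun_prop) ?_
    exact (hasCompactSupport_dv hVs).add (hs.mul_left)
  rw [polar _ hI]
  obtain ⟨R, hR0, hR⟩ := exists_radius hs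
  set A : ℝ → ℂ := fun r => ∫ σ, ∑ i, V i (r • (σ : E3)) * ((σ : E3) i : ℂ) ∂SS with hA
  set B : ℝ → ℂ := fun r => ∫ σ, dv V (r • (σ : E3)) ∂SS with hB
  set Φ : ℝ → ℂ := fun r => ∫ σ, φ (r • (σ : E3)) ∂SS with hΦ
  have hAc : Continuous A := continuous_sph (H := fun r x => ∑ i, V i (r • x) * (x i : ℂ)) (by fun_prop)
  have hBc : Continuous B := continuous_sph (H := fun r x => dv V (r • x)) (by fun_prop)
  have hΦc : Continuous Φ := continuous_sph (H := fun r x => φ (r • x)) (by fun_prop)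
  have hfl : ∀ r, flux V r = (r : ℂ) ^ 2 * A r := fun r => by
    simp only [flux, hA]; rw [integral_const_mul]
  have hΦd : ∀ r, HasDerivAt Φ (A r) r := by
    intro r
    refine hasDerivAt_sph (H := fun r x => φ (r • x)) (H' := fun r x => ∑ i, V i (r • x) * (x i : ℂ))
      (by fun_prop) (by fun_prop) ?_ r
    intro r σ
    have h3 : HasDerivAt (fun r : ℝ => r • σ) σ r := by
      simpa using (hasDerivAt_id r).smul_const σ
    have h4 := (hφ.differentiable (by norm_num) (r • σ)).hasFDerivAt.comp_hasDerivAt r h3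
    have h5 : fderiv ℝ φ (r • σ) σ = ∑ i, V i (r • σ) * (σ i : ℂ) := by
      have h6 : σ = ∑ i, σ i • eb i := by
        have := (EuclideanSpace.basisFun (Fin 3) ℝ).sum_repr σ
        simpa using this.symm
      conv_lhs => rw [h6]
      rw [map_sum]
      refine Finset.sum_congr rfl fun i _ => ?_
      rw [map_smul, ← h6]
      simp [hVdef, mul_comm]
    rw [← h5]; exact h4
  have hpi : ((4 * Real.pi : ℝ) : ℂ) ≠ 0 := by
    have := Real.pi_pos
    exact_mod_cast (by positivity : (4 * Real.pi : ℝ) ≠ 0)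
  set Z : ℝ → ℂ := fun r => Complex.exp (Complex.I * k * (r : ℝ)) *
    (r * A r + (Φ r - Complex.I * k * (r * Φ r))) / ((4 * Real.pi : ℝ) : ℂ) with hZ
  set Z' : ℝ → ℂ := fun r => Complex.exp (Complex.I * k * (r : ℝ)) *
    (r * (B r + k ^ 2 * Φ r)) / ((4 * Real.pi : ℝ) : ℂ) with hZ'
  have e : ∀ r ∈ Set.Ioi (0 : ℝ), (r ^ 2 : ℝ) • ∫ σ : sphere (0 : E3) 1,
      gk k (r • (σ : E3)) * (dv V (r • (σ : E3)) + k ^ 2 * φ (r • (σ : E3))) ∂SS = Z' r := by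
    intro r hr
    have hr0 : (r : ℂ) ≠ 0 := by exact_mod_cast (ne_of_gt hr)
    simp only [gk, norm_sph hr]
    rw [integral_const_mul, integral_add, integral_const_mul]
    · simp only [hZ', Complex.real_smul]
      push_cast at hpi ⊢
      change (r : ℂ) ^ 2 * (_ * (B r + _ * Φ r)) = _
      have hpi' : (Real.pi : ℂ) ≠ 0 := by exact_mod_cast Real.pi_ne_zero
      field_simp
    · exact (integrable_sph (H := fun x => dv V (r • x)) (by fun_prop))
    · exact (integrable_sph (H := fun x => φ (r • x)) (by fun_prop)).const_mul _
  rw [setIntegral_congr_fun measurableSet_Ioi e]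
  have hfar : ∀ r, R < r → A r = 0 ∧ B r = 0 ∧ Φ r = 0 := by
    intro r hr
    have hr0 : 0 < r := hR0.trans hr
    have hn : ∀ (σ : sphere (0 : E3) 1), r • (σ : E3) ∉ tsupport φ := fun σ =>
      hR _ (by rw [norm_sph hr0]; exact hr)
    have hn' : ∀ (σ : sphere (0 : E3) 1) i, r • (σ : E3) ∉ tsupport (V i) := fun σ i h =>
      hn σ (tsupport_fderiv_apply_subset ℝ _ h)
    refine ⟨?_, ?_, ?_⟩
    · simp only [hA]
      rw [integral_congr_ae (g := fun _ => 0) (Filter.Eventually.of_forall fun σ => ?_)]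
      · simp
      · exact Finset.sum_eq_zero fun i _ => by simp [image_eq_zero_of_notMem_tsupport (hn' σ i)]
    · simp only [hB]
      rw [integral_congr_ae (g := fun _ => 0) (Filter.Eventually.of_forall fun σ => ?_)]
      · simp
      · exact tsupport_dv (hn' σ)
    · simp only [hΦ]
      rw [integral_congr_ae (g := fun _ => 0) (Filter.Eventually.of_forall fun σ => ?_)]
      · simp
      · exact image_eq_zero_of_notMem_tsupport (hn σ)
  rw [int_Ioi (Z := Z) (Z' := Z') (by fun_prop) (by fun_prop) ?_ (R := R)
    (fun r hr => by simp [hZ, hfar r hr]) (fun r hr => by simp [hZ', hfar r hr])]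
  · simp [hZ, hΦ, cS]
    ring
  · intro r hr
    have hr0 : (r : ℂ) ≠ 0 := by exact_mod_cast (ne_of_gt hr)
    have h1 := flux_hasDerivAt hV hr
    have h2 := h1.div ((hasDerivAt_id r).ofReal_comp) (by simpa using hr0)
    have h3 : HasDerivAt (fun r : ℝ => (r : ℂ) * A r) (r * B r - A r) r := by
      have h4 : HasDerivAt (fun r : ℝ => flux V r / (r : ℂ)) (r * B r - A r) r := by
        refine h2.congr_deriv ?_
        simp only [hfl, hB, id]
        push_cast
        field_simp
      refine h4.congr_of_eventuallyEq ?_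
      filter_upwards [lt_mem_nhds hr] with t ht
      have ht0 : (t : ℂ) ≠ 0 := by exact_mod_cast (ne_of_gt ht)
      rw [hfl]; field_simp
    have h6 : HasDerivAt (fun r : ℝ => (r : ℂ) * Φ r) (Φ r + r * A r) r := by
      refine (((hasDerivAt_id r).ofReal_comp).mul (hΦd r)).congr_deriv ?_
      simp
    have h7 := h3.add ((hΦd r).sub (h6.const_mul (Complex.I * k)))
    have h5 := ((exp_hasDerivAt k r).mul h7).div_const ((4 * Real.pi : ℝ) : ℂ)
    refine h5.congr_deriv ?_
    simp only [hZ', Pi.add_apply, Pi.sub_apply]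
    have hI : Complex.I ^ 2 = -1 := Complex.I_sq
    ring_nf
    rw [hI]; ring

lemma two_le_sm : (2 : WithTop ℕ∞) ≤ ((⊤ : ℕ∞) : WithTop ℕ∞) := by
  have : ((2 : ℕ∞) : WithTop ℕ∞) ≤ ((⊤ : ℕ∞) : WithTop ℕ∞) := by exact_mod_cast le_top
  exact this

lemma fderiv_refl {φ : E3 → ℂ} (hφ : Differentiable ℝ φ) (x z v : E3) :
    fderiv ℝ (fun z => φ (x - z)) z v = - fderiv ℝ φ (x - z) v := by
  have := ((hφ (x - z)).hasFDerivAt).comp z ((hasFDerivAt_id z).const_sub x)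
  have h2 : HasFDerivAt (fun z => φ (x - z)) _ z := this
  rw [h2.fderiv]
  simp

lemma smooth_mul {a φ : E3 → ℂ} (ha : ∀ x, x ≠ 0 → ContDiffAt ℝ ((⊤ : ℕ∞) : WithTop ℕ∞) a x)
    (hφ : ContDiff ℝ ((⊤ : ℕ∞) : WithTop ℕ∞) φ) (h0 : (0 : E3) ∉ tsupport φ) :
    ContDiff ℝ ((⊤ : ℕ∞) : WithTop ℕ∞) (fun x => a x * φ x) := by
  rw [contDiff_iff_contDiffAt]
  intro x
  by_cases hx : x = 0
  · subst hx
    have : φ =ᶠ[nhds 0] 0 := notMem_tsupport_iff_eventuallyEq.mp h0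
    have h2 : (fun x => a x * φ x) =ᶠ[nhds 0] fun _ => 0 := by
      filter_upwards [this] with y hy
      simp [hy]
    exact contDiffAt_const.congr_of_eventuallyEq h2
  · exact (ha x hx).mul hφ.contDiffAt

/-- The modulated field. -/
noncomputable def Fv (k : ℂ) (f : E3 → EuclideanSpace ℂ (Fin 3)) (i : Fin 3) (x : E3) : ℂ :=
  Complex.exp (Complex.I * k * (‖x‖ : ℝ)) * f x i

/-- The source. -/
noncomputable def gsrc (k : ℂ) (f : E3 → EuclideanSpace ℂ (Fin 3)) (x : E3) : ℂ :=
  dv (Fv k f) x - Complex.I * k * ∑ i, Fv k f i x * ((x i : ℂ) * (‖x‖ : ℂ)⁻¹)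

section
variable {k : ℂ} {f : E3 → EuclideanSpace ℂ (Fin 3)}

lemma tsupp_comp (i : Fin 3) : tsupport (fun x => f x i) ⊆ tsupport f := by
  refine closure_mono ?_
  intro x hx h
  apply hx
  simp [h]

lemma tsupp_Fv (i : Fin 3) : tsupport (Fv k f i) ⊆ tsupport f := by
  refine closure_mono ?_
  intro x hx h
  apply hx
  simp [h, Fv]

lemma comp_contDiff (hf : ContDiff ℝ (⊤ : ℕ∞) f) (i : Fin 3) :
    ContDiff ℝ ((⊤ : ℕ∞) : WithTop ℕ∞) (fun x => f x i) := by
  have h2 : ContDiff ℝ ((⊤ : ℕ∞) : WithTop ℕ∞) (fun v : EuclideanSpace ℂ (Fin 3) => v i) := by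
    exact ((EuclideanSpace.proj (𝕜 := ℂ) i).restrictScalars ℝ).contDiff
  exact h2.comp hf

lemma cexp_contDiffAt (k : ℂ) {x : E3} (hx : x ≠ 0) :
    ContDiffAt ℝ ((⊤ : ℕ∞) : WithTop ℕ∞)
      (fun x : E3 => Complex.exp (Complex.I * k * (‖x‖ : ℝ))) x := by
  have h1 : ContDiffAt ℝ ((⊤ : ℕ∞) : WithTop ℕ∞) (fun x : E3 => ‖x‖) x := contDiffAt_norm ℝ hx
  have h2 : ContDiffAt ℝ ((⊤ : ℕ∞) : WithTop ℕ∞) (fun x : E3 => ((‖x‖ : ℝ) : ℂ)) x :=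
    (Complex.ofRealCLM.contDiff.contDiffAt).comp x h1
  exact (contDiffAt_const.mul h2).cexp

lemma coord_contDiffAt (i : Fin 3) {x : E3} (hx : x ≠ 0) :
    ContDiffAt ℝ ((⊤ : ℕ∞) : WithTop ℕ∞)
      (fun x : E3 => (x i : ℂ) * (‖x‖ : ℂ)⁻¹) x := by
  have h1 : ContDiffAt ℝ ((⊤ : ℕ∞) : WithTop ℕ∞) (fun x : E3 => ‖x‖) x := contDiffAt_norm ℝ hx
  have h2 : ContDiffAt ℝ ((⊤ : ℕ∞) : WithTop ℕ∞) (fun x : E3 => ((‖x‖ : ℝ) : ℂ)) x :=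
    (Complex.ofRealCLM.contDiff.contDiffAt).comp x h1
  have h3 : ContDiffAt ℝ ((⊤ : ℕ∞) : WithTop ℕ∞) (fun x : E3 => ((x i : ℝ) : ℂ)) x :=
    (Complex.ofRealCLM.contDiff.comp (EuclideanSpace.proj (𝕜 := ℝ) i).contDiff).contDiffAt
  exact h3.mul (h2.inv (by simpa using hx))

lemma Fv_contDiff (hf : ContDiff ℝ (⊤ : ℕ∞) f) (h0 : (0 : E3) ∉ tsupport f) (i : Fin 3) :
    ContDiff ℝ ((⊤ : ℕ∞) : WithTop ℕ∞) (Fv k f i) :=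
  smooth_mul (fun x hx => cexp_contDiffAt k hx) (comp_contDiff hf i)
    (fun h => h0 (tsupp_comp i h))

lemma Fv_supp (hs : HasCompactSupport f) (i : Fin 3) : HasCompactSupport (Fv k f i) :=
  hs.mono' ((subset_tsupport _).trans (tsupp_Fv i))

lemma gsrc_contDiff (hf : ContDiff ℝ (⊤ : ℕ∞) f) (h0 : (0 : E3) ∉ tsupport f) :
    ContDiff ℝ ((⊤ : ℕ∞) : WithTop ℕ∞) (gsrc k f) := by
  have hF := fun i => Fv_contDiff (k := k) hf h0 i
  have h1 : ContDiff ℝ ((⊤ : ℕ∞) : WithTop ℕ∞) (dv (Fv k f)) := by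
    unfold dv
    exact ContDiff.sum fun i _ => ((hF i).fderiv_right (by simp)).clm_apply contDiff_const
  have h2 : ContDiff ℝ ((⊤ : ℕ∞) : WithTop ℕ∞)
      (fun x => ∑ i, Fv k f i x * ((x i : ℂ) * (‖x‖ : ℂ)⁻¹)) := by
    refine ContDiff.sum fun i _ => ?_
    have := smooth_mul (fun x hx => coord_contDiffAt i hx) (hF i) (fun h => h0 (tsupp_Fv i h))
    simpa only [mul_comm] using this
  exact h1.sub (contDiff_const.mul h2)

lemma gsrc_supp (hs : HasCompactSupport f) : HasCompactSupport (gsrc k f) := by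
  have h1 : HasCompactSupport (dv (Fv k f)) := hasCompactSupport_dv (Fv_supp hs)
  have h2 : HasCompactSupport (fun x : E3 =>
      Complex.I * k * ∑ i, Fv k f i x * ((x i : ℂ) * (‖x‖ : ℂ)⁻¹)) := by
    refine hs.mono ?_
    intro x hx h
    apply hx
    simp [Fv, h]
  exact h1.sub h2

/-- The solution of the Helmholtz equation. -/
noncomputable def uu (k : ℂ) (f : E3 → EuclideanSpace ℂ (Fin 3)) (x : E3) : ℂ :=
  ∫ z, gk k z * gsrc k f (x - z)

end

lemma conv_contDiff {k : ℂ} (hk : 0 < k.im) {g : E3 → ℂ}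
    (hg : ContDiff ℝ ((⊤ : ℕ∞) : WithTop ℕ∞) g) (hs : HasCompactSupport g) :
    ContDiff ℝ ((⊤ : ℕ∞) : WithTop ℕ∞) (fun x => ∫ z, gk k z * g (x - z)) :=
  hs.contDiff_convolution_right (ContinuousLinearMap.mul ℝ ℂ) (locInt_gk hk) hg

lemma conv_fderiv {k : ℂ} (hk : 0 < k.im) {g : E3 → ℂ}
    (hg : ContDiff ℝ ((⊤ : ℕ∞) : WithTop ℕ∞) g) (hs : HasCompactSupport g) (x v : E3) :
    fderiv ℝ (fun x => ∫ z, gk k z * g (x - z)) x v = ∫ z, gk k z * fderiv ℝ g (x - z) v := by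
  have hg1 : ContDiff ℝ 1 g := hg.of_le (by exact_mod_cast le_top)
  have := (hs.hasFDerivAt_convolution_right (ContinuousLinearMap.mul ℝ ℂ) (locInt_gk hk) hg1 x).fderiv
  have h2 : (fun x => ∫ z, gk k z * g (x - z)) =
    convolution (gk k) g (ContinuousLinearMap.mul ℝ ℂ) volume := rfl
  rw [h2, this, convolution_precompR_apply _ (locInt_gk hk) (hs.fderiv ℝ)
    (hg1.continuous_fderiv (by norm_num))]
  rfl

section
variable {k : ℂ} {f : E3 → EuclideanSpace ℂ (Fin 3)}

lemma uu_contDiff (hk : 0 < k.im) (hf : ContDiff ℝ (⊤ : ℕ∞) f) (hs : HasCompactSupport f)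
    (h0 : (0 : E3) ∉ tsupport f) : ContDiff ℝ ((⊤ : ℕ∞) : WithTop ℕ∞) (uu k f) :=
  conv_contDiff hk (gsrc_contDiff hf h0) (gsrc_supp hs)

lemma uu_pde (hk : 0 < k.im) (hf : ContDiff ℝ (⊤ : ℕ∞) f) (hs : HasCompactSupport f)
    (h0 : (0 : E3) ∉ tsupport f) (x : E3) :
    dv (fun i y => fderiv ℝ (uu k f) y (eb i)) x + k ^ 2 * uu k f x
      = - (cS : ℂ) * gsrc k f x := by
  have hg := gsrc_contDiff (k := k) hf h0
  have hgs := gsrc_supp (k := k) hs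
  set g := gsrc k f with hgdef
  have hgi : ∀ i, ContDiff ℝ ((⊤ : ℕ∞) : WithTop ℕ∞) (fun y => fderiv ℝ g y (eb i)) := fun i =>
    (hg.fderiv_right (by simp)).clm_apply contDiff_const
  have hgis : ∀ i, HasCompactSupport (fun y => fderiv ℝ g y (eb i)) := fun i =>
    hgs.fderiv_apply ℝ _
  have hgii : ∀ i, ContDiff ℝ ((⊤ : ℕ∞) : WithTop ℕ∞)
      (fun z => fderiv ℝ (fun y => fderiv ℝ g y (eb i)) z (eb i)) := fun i =>
    ((hgi i).fderiv_right (by simp)).clm_apply contDiff_const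
  have hgiis : ∀ i, HasCompactSupport
      (fun z => fderiv ℝ (fun y => fderiv ℝ g y (eb i)) z (eb i)) := fun i =>
    (hgis i).fderiv_apply ℝ _
  have e1 : ∀ i y, fderiv ℝ (uu k f) y (eb i) = ∫ z, gk k z * fderiv ℝ g (y - z) (eb i) :=
    fun i y => conv_fderiv hk hg hgs y (eb i)
  have e2 : ∀ i, fderiv ℝ (fun y => fderiv ℝ (uu k f) y (eb i)) x (eb i) =
      ∫ z, gk k z * fderiv ℝ (fun y => fderiv ℝ g y (eb i)) (x - z) (eb i) := by
    intro i
    have : (fun y => fderiv ℝ (uu k f) y (eb i)) =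
      fun y => ∫ z, gk k z * (fun y => fderiv ℝ g y (eb i)) (y - z) := by
      funext y; exact e1 i y
    rw [this]
    exact conv_fderiv hk (hgi i) (hgis i) x (eb i)
  have hIntg : ∀ φ : E3 → ℂ, Continuous φ → HasCompactSupport φ →
      Integrable fun z => gk k z * φ (x - z) := by
    intro φ h1 h2
    refine int_mul (locInt_gk hk) (by fun_prop) ?_
    exact h2.comp_homeomorph (Homeomorph.subLeft x)
  have key := gk_fund hk (φ := fun z => g (x - z))
    ((hg.of_le two_le_sm).comp (contDiff_const.sub contDiff_id))
    (hgs.comp_homeomorph (Homeomorph.subLeft x))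
  have hsub : ∀ (φ : E3 → ℂ), ContDiff ℝ ((⊤ : ℕ∞) : WithTop ℕ∞) φ → ∀ z v,
      fderiv ℝ (fun z => φ (x - z)) z v = - fderiv ℝ φ (x - z) v := by
    intro φ hφ z v
    exact fderiv_refl (hφ.differentiable (by simp)) x z v
  have e3 : ∀ z, dv (fun i y => fderiv ℝ (fun z => g (x - z)) y (eb i)) z =
     ∑ i, fderiv ℝ (fun y => fderiv ℝ g y (eb i)) (x - z) (eb i) := by
    intro z
    unfold dv
    refine Finset.sum_congr rfl fun i _ => ?_
    have : (fun y => fderiv ℝ (fun z => g (x - z)) y (eb i)) =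
      fun y => - (fun w => fderiv ℝ g w (eb i)) (x - y) := by
      funext y; exact hsub g hg y _
    beta_reduce
    rw [this, fderiv_fun_neg, neg_apply, hsub _ (hgi i), neg_neg]
  simp only [sub_zero] at key
  rw [← key]
  unfold dv
  rw [Finset.sum_congr rfl (fun i _ => e2 i)]
  rw [← integral_finsetSum _ (fun i _ => hIntg _ (hgii i).continuous (hgiis i))]
  have : k ^ 2 * uu k f x = ∫ z, k ^ 2 * (gk k z * g (x - z)) := by
    rw [integral_const_mul]; rfl
  rw [this, ← integral_add]
  · refine integral_congr_ae (Filter.Eventually.of_forall fun z => ?_)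
    have := e3 z
    unfold dv at this
    simp only
    rw [this, ← Finset.mul_sum]
    ring
  · exact integrable_finsetSum _ (fun i _ => hIntg _ (hgii i).continuous (hgiis i))
  · exact (hIntg _ hg.continuous hgs).const_mul _

lemma gk_hasFDerivAt (k : ℂ) {z : E3} (hz : z ≠ 0) (i : Fin 3) :
    DifferentiableAt ℝ (gk k) z ∧ fderiv ℝ (gk k) z (eb i) = gk' k i z := by
  have hz' : (‖z‖ : ℂ) ≠ 0 := by simpa using hz
  have h1 := hasFDerivAt_norm3 hz
  have hr : HasDerivAt (fun r : ℝ => Complex.exp (Complex.I * k * (r : ℝ)) / ((4 * Real.pi * r : ℝ) : ℂ))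
      (Complex.exp (Complex.I * k * (‖z‖ : ℝ)) / ((4 * Real.pi * ‖z‖ : ℝ) : ℂ) *
        (Complex.I * k - (‖z‖ : ℂ)⁻¹)) ‖z‖ := by
    have ha := exp_hasDerivAt k ‖z‖
    have hb : HasDerivAt (fun r : ℝ => ((4 * Real.pi * r : ℝ) : ℂ)) ((4 * Real.pi : ℝ) : ℂ) ‖z‖ := by
      have := ((hasDerivAt_id ‖z‖).const_mul (4 * Real.pi)).ofReal_comp
      simpa using this
    have hpi : ((4 * Real.pi : ℝ) : ℂ) ≠ 0 := by
      exact_mod_cast (by positivity : (4 * Real.pi : ℝ) ≠ 0)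
    have hne : ((4 * Real.pi * ‖z‖ : ℝ) : ℂ) ≠ 0 := by
      rw [Complex.ofReal_mul]; exact mul_ne_zero hpi hz'
    refine (ha.div hb hne).congr_deriv ?_
    rw [Complex.ofReal_mul (4 * Real.pi)]
    field_simp
  have h2 := hr.hasFDerivAt.comp z h1
  have h3 : HasFDerivAt (gk k) _ z := h2
  refine ⟨h3.differentiableAt, ?_⟩
  rw [h3.fderiv]
  simp [gk', inner_eb]
  ring

lemma mu4_eq (hk : 0 < k.im) (hf : ContDiff ℝ (⊤ : ℕ∞) f) (hs : HasCompactSupport f)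
    (h0 : (0 : E3) ∉ tsupport f) (r : ℝ) (σ : E3) :
    mu4 k f r σ = r * Complex.exp (-(Complex.I * k * (r : ℝ))) * uu k f (r • σ) := by
  have hF := fun i => Fv_contDiff (k := k) hf h0 i
  have hFs := fun i => Fv_supp (k := k) hs i
  set x := r • σ with hx
  set E := Complex.exp (-(Complex.I * k * (r : ℝ))) with hE
  have hker : (fun z => ker4 k r σ z) = fun y => E *
      (gk k (x - y) * Complex.exp (Complex.I * k * (‖y‖ : ℝ))) := by
    funext y
    unfold ker4 gk
    rw [← hx]
    have : Complex.exp (Complex.I * k * ((-r + ‖x - y‖ + ‖y‖ : ℝ) : ℂ)) =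
       E * (Complex.exp (Complex.I * k * (‖x - y‖ : ℝ)) * Complex.exp (Complex.I * k * (‖y‖ : ℝ))) := by
      rw [hE, ← Complex.exp_add, ← Complex.exp_add]
      congr 1
      push_cast
      ring
    rw [this]
    ring
  have hpt : ∀ y, y ≠ x → ∑ i : Fin 3,
    fderiv ℝ (fun z => ker4 k r σ z) y (EuclideanSpace.single i 1) * f y i =
     -E * (∑ i, gk' k i (x - y) * Fv k f i y - gk k (x - y) * (Complex.I * k * ∑ i, Fv k f i y * ((y i : ℂ) * (‖y‖ : ℂ)⁻¹))) := by
    intro y hy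
    by_cases hy0 : y = 0
    · have : f y = 0 := by
        rw [hy0]; exact image_eq_zero_of_notMem_tsupport h0
      simp [Fv, this]
    have hxy : x - y ≠ 0 := sub_ne_zero.mpr hy.symm
    have hy' : (‖y‖ : ℂ) ≠ 0 := by simpa using hy0
    have hexp := (exp_hasDerivAt k ‖y‖).hasFDerivAt.comp y (hasFDerivAt_norm3 hy0)
    have hgd : ∀ i, DifferentiableAt ℝ (gk k) (x - y) := fun i => (gk_hasFDerivAt k hxy i).1
    have hgd' : HasFDerivAt (fun y => gk k (x - y)) (-fderiv ℝ (gk k) (x - y)) y := by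
      have := ((hgd 0).hasFDerivAt).comp y ((hasFDerivAt_id y).const_sub x)
      refine this.congr_fderiv ?_
      ext v
      simp
    have htot := ((hgd'.mul hexp).const_mul E)
    rw [hker, HasFDerivAt.fderiv (f := fun y => E *
      (gk k (x - y) * Complex.exp (Complex.I * k * (‖y‖ : ℝ)))) htot]
    have hi : ∀ i, fderiv ℝ (gk k) (x - y) (eb i) = gk' k i (x - y) := fun i => (gk_hasFDerivAt k hxy i).2
    rw [Finset.mul_sum, Finset.mul_sum, ← Finset.sum_sub_distrib, Finset.mul_sum]
    refine Finset.sum_congr rfl fun i _ => ?_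
    have hi' := hi i
    have hin := inner_eb y i
    unfold eb at hi' hin
    simp only [smul_apply, add_apply, neg_apply, hi', Fv, smul_eq_mul, Function.comp]
    push_cast
    simp
    rw [hin]
    ring
  unfold mu4
  have hae : ∀ᵐ y : E3, y ≠ x := by
    have := (measure_singleton (μ := (volume : Measure E3)) x)
    exact compl_mem_ae_iff.mpr this
  rw [integral_congr_ae (hae.mono hpt), integral_const_mul]
  rw [← integral_sub_left_eq_self _ volume x]
  simp only [sub_sub_cancel]
  have hV1 : ∀ i, ContDiff ℝ 1 (fun z => Fv k f i (x - z)) := fun i =>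
    ((hF i).of_le (by exact_mod_cast le_top)).comp (contDiff_const.sub contDiff_id)
  have hVs : ∀ i, HasCompactSupport (fun z => Fv k f i (x - z)) := fun i =>
    (hFs i).comp_homeomorph (Homeomorph.subLeft x)
  have hdv : ∀ z, dv (fun i z => Fv k f i (x - z)) z = - dv (Fv k f) (x - z) := by
    intro z
    unfold dv
    rw [← Finset.sum_neg_distrib]
    refine Finset.sum_congr rfl fun i _ => ?_
    exact fderiv_refl ((hF i).differentiable (by simp)) x z _
  have hcg : Continuous fun z => Complex.I * k * ∑ i, Fv k f i z * ((z i : ℂ) * (‖z‖ : ℂ)⁻¹) := by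
    have h1 : (fun z => Complex.I * k * ∑ i, Fv k f i z * ((z i : ℂ) * (‖z‖ : ℂ)⁻¹)) =
      fun z => dv (Fv k f) z - gsrc k f z := by funext z; simp [gsrc]
    rw [h1]
    exact (continuous_dv fun i => (hF i).of_le (by exact_mod_cast le_top)).sub (gsrc_contDiff hf h0).continuous
  have hcs : HasCompactSupport fun z : E3 => Complex.I * k * ∑ i, Fv k f i z * ((z i : ℂ) * (‖z‖ : ℂ)⁻¹) := by
    refine hs.mono ?_
    intro x hx h
    apply hx
    simp [Fv, h]
  have hI2 : Integrable fun z => gk k z * (Complex.I * k * ∑ i, Fv k f i (x - z) * (((x - z) i : ℂ) * (‖x - z‖ : ℂ)⁻¹)) :=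
    int_mul (φ := fun z => Complex.I * k * ∑ i, Fv k f i (x - z) * (((x - z) i : ℂ) * (‖x - z‖ : ℂ)⁻¹)) (locInt_gk hk) (hcg.comp (continuous_const.sub continuous_id))
      (hcs.comp_homeomorph (Homeomorph.subLeft x))
  rw [integral_sub (integrable_finsetSum _ fun i _ => int_mul (locInt_gk' hk i) (hV1 i).continuous (hVs i)) hI2]
  rw [gk_ibp hk hV1 hVs]
  have hI3 : Integrable fun z => gk k z * dv (Fv k f) (x - z) :=
    int_mul (locInt_gk hk) ((continuous_dv fun i => (hF i).of_le (by exact_mod_cast le_top)).comp (continuous_const.sub continuous_id))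
      ((hasCompactSupport_dv hFs).comp_homeomorph (Homeomorph.subLeft x))
  have e4 : uu k f x = (∫ z, gk k z * dv (Fv k f) (x - z)) - ∫ z, gk k z * (Complex.I * k * ∑ i, Fv k f i (x - z) * (((x - z) i : ℂ) * (‖x - z‖ : ℂ)⁻¹)) := by
    rw [← integral_sub hI3 hI2]
    unfold uu gsrc
    refine integral_congr_ae (Filter.Eventually.of_forall fun z => ?_)
    simp only
    ring
  simp only [hdv, mul_neg, integral_neg, neg_neg]
  rw [e4]
  ring

lemma uu_decay (hk : 0 < k.im) (hf : ContDiff ℝ (⊤ : ℕ∞) f) (hs : HasCompactSupport f)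
    (h0 : (0 : E3) ∉ tsupport f) : ∃ C R : ℝ, 0 < R ∧ ∀ x : E3, R ≤ ‖x‖ →
      ‖x‖ * Real.exp (k.im * ‖x‖) * ‖uu k f x‖ ≤ C := by
  have hg := gsrc_contDiff (k := k) hf h0
  have hgs := gsrc_supp (k := k) hs
  obtain ⟨ρ, hρ, hρ'⟩ := exists_radius hgs
  have hgi : Integrable (gsrc k f) := hg.continuous.integrable_of_hasCompactSupport hgs
  refine ⟨2 * Real.exp (k.im * ρ) * ∫ y, ‖gsrc k f y‖, 2 * ρ, by positivity, fun x hx => ?_⟩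
  have hx0 : 0 < ‖x‖ := by linarith
  have e1 : uu k f x = ∫ y, gk k (x - y) * gsrc k f y := by
    unfold uu
    rw [← integral_sub_left_eq_self _ volume x]
    simp only [sub_sub_cancel]
  have hb : ∀ y, ‖gk k (x - y) * gsrc k f y‖ ≤
      (2 * Real.exp (k.im * ρ) * (‖x‖ * Real.exp (k.im * ‖x‖))⁻¹) * ‖gsrc k f y‖ := by
    intro y
    rw [norm_mul]
    by_cases hy : ρ < ‖y‖
    · have : gsrc k f y = 0 := image_eq_zero_of_notMem_tsupport (hρ' y hy)
      simp [this]
    refine mul_le_mul_of_nonneg_right ?_ (norm_nonneg _)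
    push Not at hy
    have hxy : ‖x‖ - ρ ≤ ‖x - y‖ := by
      have := norm_sub_norm_le x y
      linarith
    have hxy2 : ‖x‖ / 2 ≤ ‖x - y‖ := by linarith
    have hxy0 : 0 < ‖x - y‖ := by linarith
    unfold gk
    rw [norm_div, Complex.norm_real, Real.norm_of_nonneg (by positivity), Complex.norm_exp]
    have e2 : (Complex.I * k * (‖x - y‖ : ℝ)).re = - (k.im * ‖x - y‖) := by simp
    rw [e2, div_le_iff₀ (by positivity)]
    have h3 : Real.exp (-(k.im * ‖x - y‖)) ≤ Real.exp (k.im * ρ) * (Real.exp (k.im * ‖x‖))⁻¹ := by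
      rw [← Real.exp_neg, ← Real.exp_add]
      apply Real.exp_le_exp.mpr
      nlinarith
    refine h3.trans ?_
    rw [mul_inv]
    have h4 : 1 ≤ 2 * ‖x‖⁻¹ * (4 * Real.pi * ‖x - y‖) := by
      have : 1 ≤ 2 * ‖x‖⁻¹ * (1 * (‖x‖ / 2)) := by
        field_simp; norm_num
      refine this.trans ?_
      have := Real.pi_gt_three
      gcongr
      linarith
    calc _ ≤ Real.exp (k.im * ρ) * (Real.exp (k.im * ‖x‖))⁻¹ * (2 * ‖x‖⁻¹ * (4 * Real.pi * ‖x - y‖)) :=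
          le_mul_of_one_le_right (by positivity) h4
      _ = _ := by ring
  have h5 : ‖uu k f x‖ ≤ (2 * Real.exp (k.im * ρ) * (‖x‖ * Real.exp (k.im * ‖x‖))⁻¹) *
      ∫ y, ‖gsrc k f y‖ := by
    rw [e1, ← integral_const_mul]
    exact norm_integral_le_of_norm_le (hgi.norm.const_mul _) (Filter.Eventually.of_forall hb)
  have h6 : 0 < ‖x‖ * Real.exp (k.im * ‖x‖) := by positivity
  calc _ ≤ ‖x‖ * Real.exp (k.im * ‖x‖) * _ := mul_le_mul_of_nonneg_left h5 h6.le
    _ = _ := by field_simp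

end

open ComplexConjugate

noncomputable section

/-- Exponential factor. -/
def En (k : ℂ) (r : ℝ) : ℂ := Complex.exp (-(Complex.I * k * (r : ℝ)))

/-- gradient component -/
def Du (u : E3 → ℂ) (i : Fin 3) (x : E3) : ℂ := fderiv ℝ u x (eb i)

def Mu (k : ℂ) (u : E3 → ℂ) (r : ℝ) (x : E3) : ℂ := r * En k r * u (r • x)

def Mu' (k : ℂ) (u : E3 → ℂ) (r : ℝ) (x : E3) : ℂ :=
  En k r * ((1 - Complex.I * k * r) * u (r • x) + r * ∑ i, (x i : ℂ) * Du u i (r • x))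

def Bb (k : ℂ) (u : E3 → ℂ) (i : Fin 3) (r : ℝ) (x : E3) : ℂ :=
  En k r * ((x i : ℂ) * (1 - Complex.I * k * r) * u (r • x) + r * Du u i (r • x))

def fE (k : ℂ) (F : Fin 3 → E3 → ℂ) (i : Fin 3) (r : ℝ) (x : E3) : ℂ := En k r * F i (r • x)

def Pd (k : ℂ) (u : E3 → ℂ) (r : ℝ) (x : E3) : ℂ := Mu' k u r x * conj (Mu k u r x)

def Qd (k : ℂ) (u : E3 → ℂ) (F : Fin 3 → E3 → ℂ) (r : ℝ) (x : E3) : ℂ :=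
  cS * (r * conj (Mu k u r x) * ∑ i, (x i : ℂ) * fE k F i r x)

def Sd (k : ℂ) (u : E3 → ℂ) (F : Fin 3 → E3 → ℂ) (r : ℝ) (x : E3) : ℂ :=
  cS * ∑ i, (r * fE k F i r x * conj (Bb k u i r x) - (x i : ℂ) * fE k F i r x * conj (Mu k u r x))

def Ed (k : ℂ) (u : E3 → ℂ) (r : ℝ) (x : E3) : ℂ :=
  ∑ i, Bb k u i r x * conj (Bb k u i r x)

lemma En_cont (k : ℂ) : Continuous (En k) := by unfold En; fun_prop

lemma En_hasDerivAt (k : ℂ) (r : ℝ) : HasDerivAt (En k) (-(Complex.I * k) * En k r) r := by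
  have h1 : HasDerivAt (fun r : ℝ => -(Complex.I * k * (r : ℝ))) (-(Complex.I * k)) r := by
    have := (((hasDerivAt_id r).ofReal_comp).const_mul (Complex.I * k)).neg
    refine HasDerivAt.congr_deriv (f := fun r : ℝ => -(Complex.I * k * (r : ℝ))) this ?_
    simp
  have := h1.cexp
  rw [mul_comm (Complex.exp _)] at this
  exact this

lemma conj_En (k : ℂ) (r : ℝ) : conj (En k r) = Complex.exp (Complex.I * conj k * (r : ℝ)) := by
  unfold En
  rw [← Complex.exp_conj]
  simp

lemma coord_cont (i : Fin 3) : Continuous fun z : ℝ × E3 => ((z.2 i : ℝ) : ℂ) := by fun_prop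

section
variable {k : ℂ} {u : E3 → ℂ} {F : Fin 3 → E3 → ℂ}

lemma Du_cont (hu : ContDiff ℝ 1 u) (i : Fin 3) : Continuous (Du u i) :=
  (hu.continuous_fderiv (by norm_num)).clm_apply continuous_const

lemma Mu_cont (hu : ContDiff ℝ 1 u) : Continuous fun z : ℝ × E3 => Mu k u z.1 z.2 := by
  have h1 := En_cont k
  have h2 := hu.continuous
  unfold Mu; fun_prop

lemma Mu'_cont (hu : ContDiff ℝ 1 u) : Continuous fun z : ℝ × E3 => Mu' k u z.1 z.2 := by
  have h1 := En_cont k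
  have h2 := hu.continuous
  have h3 := fun i => Du_cont hu i
  unfold Mu'; fun_prop

lemma Bb_cont (hu : ContDiff ℝ 1 u) (i : Fin 3) : Continuous fun z : ℝ × E3 => Bb k u i z.1 z.2 := by
  have h1 := En_cont k
  have h2 := hu.continuous
  have h3 := fun i => Du_cont hu i
  unfold Bb; fun_prop

lemma fE_cont (hF : ∀ i, Continuous (F i)) (i : Fin 3) :
    Continuous fun z : ℝ × E3 => fE k F i z.1 z.2 := by
  have h1 := En_cont k
  unfold fE; fun_prop

lemma Pd_cont (hu : ContDiff ℝ 1 u) : Continuous fun z : ℝ × E3 => Pd k u z.1 z.2 := by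
  unfold Pd
  exact (Mu'_cont hu).mul (Complex.continuous_conj.comp (Mu_cont hu))

lemma Qd_cont (hu : ContDiff ℝ 1 u) (hF : ∀ i, Continuous (F i)) :
    Continuous fun z : ℝ × E3 => Qd k u F z.1 z.2 := by
  unfold Qd
  have h1 := Complex.continuous_conj.comp (Mu_cont (k := k) hu)
  have h2 := fun i => fE_cont (k := k) hF i
  have h3 : Continuous fun z : ℝ × E3 => ∑ i, (z.2 i : ℂ) * fE k F i z.1 z.2 :=
    continuous_finsetSum _ fun i _ => (coord_cont i).mul (h2 i)
  have h4 : Continuous fun z : ℝ × E3 => (z.1 : ℂ) := by fun_prop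
  exact continuous_const.mul ((h4.mul h1).mul h3)

lemma Sd_cont (hu : ContDiff ℝ 1 u) (hF : ∀ i, Continuous (F i)) :
    Continuous fun z : ℝ × E3 => Sd k u F z.1 z.2 := by
  unfold Sd
  have h1 := Complex.continuous_conj.comp (Mu_cont (k := k) hu)
  have h2 := fun i => fE_cont (k := k) hF i
  have h5 := fun i => Complex.continuous_conj.comp (Bb_cont (k := k) hu i)
  have h4 : Continuous fun z : ℝ × E3 => (z.1 : ℂ) := by fun_prop
  refine continuous_const.mul (continuous_finsetSum _ fun i _ => ?_)
  exact ((h4.mul (h2 i)).mul (h5 i)).sub (((coord_cont i).mul (h2 i)).mul h1)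

lemma Ed_cont (hu : ContDiff ℝ 1 u) : Continuous fun z : ℝ × E3 => Ed k u z.1 z.2 := by
  unfold Ed
  exact continuous_finsetSum _ fun i _ => (Bb_cont hu i).mul (Complex.continuous_conj.comp (Bb_cont hu i))

lemma sum_smul_eb (x : E3) : ∑ i, (x i) • (eb i) = x := by
  ext j
  fin_cases j <;> simp [Fin.sum_univ_three]

lemma comp_hasDerivAt (hu : ContDiff ℝ 1 u) (r : ℝ) (x : E3) :
    HasDerivAt (fun r : ℝ => u (r • x)) (∑ i, (x i : ℂ) * Du u i (r • x)) r := by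
  have h1 : HasDerivAt (fun r : ℝ => r • x) x r := by
    simpa using (hasDerivAt_id r).smul_const x
  have h2 := ((hu.differentiable (by norm_num)) (r • x)).hasFDerivAt.comp_hasDerivAt r h1
  refine h2.congr_deriv ?_
  conv_lhs => rw [← sum_smul_eb x]
  rw [map_sum]
  refine Finset.sum_congr rfl fun i _ => ?_
  rw [map_smul, sum_smul_eb]
  simp [Du]

lemma Mu_hasDerivAt (hu : ContDiff ℝ 1 u) (r : ℝ) (x : E3) :
    HasDerivAt (fun r => Mu k u r x) (Mu' k u r x) r := by
  have h0 : HasDerivAt (fun r : ℝ => (r : ℂ)) 1 r := by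
    simpa using (hasDerivAt_id r).ofReal_comp
  have := (h0.mul (En_hasDerivAt k r)).mul (comp_hasDerivAt hu r x)
  refine this.congr_deriv ?_
  simp only [Mu', Pi.mul_apply]
  ring

lemma m_hasDerivAt (hu : ContDiff ℝ 1 u) (r : ℝ) :
    HasDerivAt (fun r => ∫ σ : sphere (0 : E3) 1, Mu k u r σ * conj (Mu k u r σ) ∂SS)
      (∫ σ : sphere (0 : E3) 1, (Pd k u r σ + conj (Pd k u r σ)) ∂SS) r := by
  refine hasDerivAt_sph (H := fun r x => Mu k u r x * conj (Mu k u r x))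
    (H' := fun r x => Pd k u r x + conj (Pd k u r x)) ?_ ?_ ?_ r
  · exact (Mu_cont hu).mul (Complex.continuous_conj.comp (Mu_cont hu))
  · exact (Pd_cont hu).add (Complex.continuous_conj.comp (Pd_cont hu))
  · intro r x
    have h1 := Mu_hasDerivAt (k := k) hu r x
    have h2 : HasDerivAt (fun r => conj (Mu k u r x)) (conj (Mu' k u r x)) r := by
      exact (Complex.conjCLE.toContinuousLinearMap.hasFDerivAt).comp_hasDerivAt r h1
    refine (h1.mul h2).congr_deriv ?_
    simp [Pd]
    ring

lemma sphere_coord (σ : sphere (0 : E3) 1) :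
    ∑ i, ((σ : E3) i : ℂ) * ((σ : E3) i : ℂ) = 1 := by
  have h1 : ‖(σ : E3)‖ = 1 := by simp
  rw [EuclideanSpace.norm_eq, Real.sqrt_eq_one] at h1
  have : ∑ i, ((σ : E3) i) * ((σ : E3) i) = 1 := by
    refine Eq.trans ?_ h1
    refine Finset.sum_congr rfl fun i _ => ?_
    rw [Real.norm_eq_abs, sq_abs, sq]
  exact_mod_cast this

lemma two_eta (k : ℂ) : ((2 * k.im : ℝ) : ℂ) = -Complex.I * k + Complex.I * conj k := by
  apply Complex.ext <;> simp; ring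

/-- The vector field whose flux is considered. -/
def Vv (u : E3 → ℂ) (F : Fin 3 → E3 → ℂ) (i : Fin 3) (x : E3) : ℂ :=
  conj (u x) * (Du u i x + cS * F i x)

lemma conj_contDiff {n : WithTop ℕ∞} (hu : ContDiff ℝ n u) : ContDiff ℝ n fun x => conj (u x) :=
  Complex.conjCLE.toContinuousLinearMap.contDiff.comp hu

lemma Du_contDiff (hu : ContDiff ℝ 2 u) (i : Fin 3) : ContDiff ℝ 1 (Du u i) :=
  (hu.fderiv_right (m := 1) (by norm_num)).clm_apply contDiff_const

lemma Vv_contDiff (hu : ContDiff ℝ 2 u) (hF : ∀ i, ContDiff ℝ 1 (F i)) (i : Fin 3) :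
    ContDiff ℝ 1 (Vv u F i) :=
  (conj_contDiff (hu.of_le (by norm_num))).mul ((Du_contDiff hu i).add (contDiff_const.mul (hF i)))

lemma dv_Vv (hu : ContDiff ℝ 2 u) (hF : ∀ i, ContDiff ℝ 1 (F i)) (x : E3) :
    dv (Vv u F) x = ∑ i, conj (Du u i x) * (Du u i x + cS * F i x) +
      conj (u x) * (dv (Du u) x + cS * dv F x) := by
  unfold dv
  rw [Finset.mul_sum (a := (cS : ℂ)), ← Finset.sum_add_distrib, Finset.mul_sum, ← Finset.sum_add_distrib]
  refine Finset.sum_congr rfl fun i _ => ?_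
  have h1 := ((hu.differentiable (by norm_num)) x).hasFDerivAt
  have h2 := Complex.conjCLE.toContinuousLinearMap.hasFDerivAt.comp x h1
  have h3 := (((Du_contDiff hu i).differentiable (by norm_num)) x).hasFDerivAt
  have h4 := (((hF i).differentiable (by norm_num)) x).hasFDerivAt
  have h5 := h2.mul (h3.add (h4.const_mul (cS : ℂ)))
  rw [HasFDerivAt.fderiv (f := Vv u F i) h5]
  simp [Du]
  ring

lemma W_eq (r : ℝ) (hu : ContDiff ℝ 2 u) (hF : ∀ i, ContDiff ℝ 1 (F i)) :
    ∫ σ : sphere (0 : E3) 1, (Pd k u r σ + Qd k u F r σ) ∂SS =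
    En k r * conj (En k r) * (flux (Vv u F) r + ((r : ℂ) - Complex.I * k * r ^ 2) *
      ∫ σ : sphere (0 : E3) 1, u (r • (σ : E3)) * conj (u (r • (σ : E3))) ∂SS) := by
  unfold flux
  have hV := fun i => (Vv_contDiff hu hF i).continuous
  have huc := hu.continuous
  have huc' : Continuous fun x => conj (u x) := Complex.continuous_conj.comp huc
  have i1 : Integrable (fun σ : sphere (0 : E3) 1 => (r : ℂ) ^ 2 * ∑ i, Vv u F i (r • (σ : E3)) * ((σ : E3) i : ℂ)) SS := by
    refine integrable_sph (H := fun x => (r : ℂ) ^ 2 * ∑ i, Vv u F i (r • x) * (x i : ℂ)) ?_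
    fun_prop
  have i2 : Integrable (fun σ : sphere (0 : E3) 1 => u (r • (σ : E3)) * conj (u (r • (σ : E3)))) SS := by
    refine integrable_sph (H := fun x => u (r • x) * conj (u (r • x))) ?_
    fun_prop
  rw [← integral_const_mul, ← integral_add i1 (i2.const_mul _), ← integral_const_mul]
  refine integral_congr_ae (Filter.Eventually.of_forall fun σ => ?_)
  simp only [Pd, Qd, Mu, Mu', fE, Vv, Fin.sum_univ_three, map_mul, Complex.conj_ofReal]
  ring

lemma W_hasDerivAt (hu : ContDiff ℝ 2 u) (hF : ∀ i, ContDiff ℝ 1 (F i))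
    (hpde : ∀ x, dv (Du u) x + k ^ 2 * u x = - (cS : ℂ) *
      (dv F x - Complex.I * k * ∑ i, F i x * ((x i : ℂ) * (‖x‖ : ℂ)⁻¹)))
    {r : ℝ} (hr : 0 < r) :
    HasDerivAt (fun r => ∫ σ : sphere (0 : E3) 1, (Pd k u r σ + Qd k u F r σ) ∂SS)
      (∫ σ : sphere (0 : E3) 1, (Ed k u r σ - 2 * Complex.I * k * Pd k u r σ + Sd k u F r σ) ∂SS) r := by
  have hu1 : ContDiff ℝ 1 u := hu.of_le (by norm_num)
  have hfun : (fun r => ∫ σ : sphere (0 : E3) 1, (Pd k u r σ + Qd k u F r σ) ∂SS) = fun r =>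
    En k r * conj (En k r) * (flux (Vv u F) r + ((r : ℂ) - Complex.I * k * r ^ 2) *
      ∫ σ : sphere (0 : E3) 1, u (r • (σ : E3)) * conj (u (r • (σ : E3))) ∂SS) := by
    funext r; exact W_eq r hu hF
  rw [hfun]
  have h1 := En_hasDerivAt k r
  have h2 : HasDerivAt (fun r => conj (En k r)) (conj (-(Complex.I * k) * En k r)) r := by
    exact (Complex.conjCLE.toContinuousLinearMap.hasFDerivAt).comp_hasDerivAt r h1
  have h3 := flux_hasDerivAt (fun i => Vv_contDiff hu hF i) hr
  have h4 : HasDerivAt (fun r : ℝ => (r : ℂ)) 1 r := by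
    simpa using (hasDerivAt_id r).ofReal_comp
  have h5 : HasDerivAt (fun r : ℝ => (r : ℂ) - Complex.I * k * r ^ 2)
      (1 - Complex.I * k * (2 * r)) r := by
    have := h4.sub (((h4.pow 2)).const_mul (Complex.I * k))
    refine this.congr_deriv ?_
    simp
  have huc := hu.continuous
  have huc' : Continuous fun x => conj (u x) := Complex.continuous_conj.comp huc
  have hDc : ∀ i, Continuous (Du u i) := fun i => Du_cont hu1 i
  have hDc' : ∀ i, Continuous fun x => conj (Du u i x) := fun i => Complex.continuous_conj.comp (hDc i)
  have hFc : ∀ i, Continuous (F i) := fun i => (hF i).continuous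
  have h6 : HasDerivAt (fun r : ℝ => ∫ σ : sphere (0 : E3) 1, u (r • (σ : E3)) * conj (u (r • (σ : E3))) ∂SS)
     (∫ σ : sphere (0 : E3) 1, ((∑ i, ((σ : E3) i : ℂ) * Du u i (r • (σ : E3))) * conj (u (r • (σ : E3))) +
        u (r • (σ : E3)) * ∑ i, ((σ : E3) i : ℂ) * conj (Du u i (r • (σ : E3)))) ∂SS) r := by
    refine hasDerivAt_sph (H := fun r x => u (r • x) * conj (u (r • x)))
      (H' := fun r x => (∑ i, (x i : ℂ) * Du u i (r • x)) * conj (u (r • x)) +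
        u (r • x) * ∑ i, (x i : ℂ) * conj (Du u i (r • x))) ?_ ?_ ?_ r
    · fun_prop
    · fun_prop
    · intro r x
      have a1 := comp_hasDerivAt hu1 r x
      have a2 : HasDerivAt (fun r => conj (u (r • x))) (conj (∑ i, (x i : ℂ) * Du u i (r • x))) r := by
        exact (Complex.conjCLE.toContinuousLinearMap.hasFDerivAt).comp_hasDerivAt r a1
      refine (a1.mul a2).congr_deriv ?_
      simp [map_sum]
  have h7 := (h1.mul h2).mul (h3.add (h5.mul h6))
  refine HasDerivAt.congr_deriv (f := fun r => En k r * conj (En k r) * (flux (Vv u F) r + ((r : ℂ) - Complex.I * k * r ^ 2) *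
      ∫ σ : sphere (0 : E3) 1, u (r • (σ : E3)) * conj (u (r • (σ : E3))) ∂SS)) h7 ?_
  simp only [Pi.mul_apply, Pi.add_apply]
  have hdvc : Continuous (dv (Vv u F)) := continuous_dv (fun i => Vv_contDiff hu hF i)
  have i1 : Integrable (fun σ : sphere (0 : E3) 1 => (r : ℂ) ^ 2 * ∑ i, Vv u F i (r • (σ : E3)) * ((σ : E3) i : ℂ)) SS := by
    have hV := fun i => (Vv_contDiff hu hF i).continuous
    refine integrable_sph (H := fun x => (r : ℂ) ^ 2 * ∑ i, Vv u F i (r • x) * (x i : ℂ)) ?_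
    fun_prop
  have i2 : Integrable (fun σ : sphere (0 : E3) 1 => u (r • (σ : E3)) * conj (u (r • (σ : E3)))) SS := by
    refine integrable_sph (H := fun x => u (r • x) * conj (u (r • x))) ?_
    fun_prop
  have i3 : Integrable (fun σ : sphere (0 : E3) 1 => dv (Vv u F) (r • (σ : E3))) SS := by
    refine integrable_sph (H := fun x => dv (Vv u F) (r • x)) ?_
    fun_prop
  have i4 : Integrable (fun σ : sphere (0 : E3) 1 => ((∑ i, ((σ : E3) i : ℂ) * Du u i (r • (σ : E3))) * conj (u (r • (σ : E3))) +
        u (r • (σ : E3)) * ∑ i, ((σ : E3) i : ℂ) * conj (Du u i (r • (σ : E3))))) SS := by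
    refine integrable_sph (H := fun x => (∑ i, (x i : ℂ) * Du u i (r • x)) * conj (u (r • x)) +
        u (r • x) * ∑ i, (x i : ℂ) * conj (Du u i (r • x))) ?_
    fun_prop
  have i5 : Integrable (fun σ : sphere (0 : E3) 1 =>
      (1 - Complex.I * k * (2 * r)) * (u (r • (σ : E3)) * conj (u (r • (σ : E3)))) +
      ((r : ℂ) - Complex.I * k * r ^ 2) * ((∑ i, ((σ : E3) i : ℂ) * Du u i (r • (σ : E3))) * conj (u (r • (σ : E3))) +
        u (r • (σ : E3)) * ∑ i, ((σ : E3) i : ℂ) * conj (Du u i (r • (σ : E3))))) SS :=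
    (i2.const_mul _).add (i4.const_mul _)
  unfold flux
  simp only [← integral_const_mul]
  rw [← integral_add (i2.const_mul _) (i4.const_mul _), ← integral_add i1 (i2.const_mul _),
    ← integral_const_mul, ← integral_add (i3.const_mul _) i5,
    ← integral_const_mul, ← integral_add]
  rotate_left
  · exact (i1.add (i2.const_mul _)).const_mul _
  · exact ((i3.const_mul _).add ((i2.const_mul _).add (i4.const_mul _))).const_mul _
  refine integral_congr_ae (Filter.Eventually.of_forall fun σ => ?_)
  have hs := sphere_coord σ
  have hn := norm_sph hr σ
  have hp := hpde (r • (σ : E3))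
  have hp2 : ∀ i, (((r • (σ : E3)) i : ℝ) : ℂ) * ((‖r • (σ : E3)‖ : ℝ) : ℂ)⁻¹ = ((σ : E3) i : ℂ) := by
    intro i
    rw [hn]
    have : (r : ℂ) ≠ 0 := by exact_mod_cast hr.ne'
    simp
    field_simp
  simp only [hp2] at hp
  have hd := dv_Vv hu hF (r • (σ : E3))
  have hp3 : dv (Du u) (r • (σ : E3)) = - (cS : ℂ) *
      (dv F (r • (σ : E3)) - Complex.I * k * ∑ i, F i (r • (σ : E3)) * ((σ : E3) i : ℂ)) - k ^ 2 * u (r • (σ : E3)) := by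
    rw [← hp]; ring
  rw [hp3] at hd
  simp only [hd]
  simp only [Fin.sum_univ_three] at hs
  simp only [Pd, Sd, Ed, Bb, Mu, Mu', fE, Vv, Fin.sum_univ_three, map_mul, map_add, map_sub, map_neg, map_one, Complex.conj_ofReal, Complex.conj_I]
  generalize u (r • (σ : E3)) = U0
  generalize Du u 0 (r • (σ : E3)) = D0
  generalize Du u 1 (r • (σ : E3)) = D1
  generalize Du u 2 (r • (σ : E3)) = D2
  generalize F 0 (r • (σ : E3)) = F0
  generalize F 1 (r • (σ : E3)) = F1
  generalize F 2 (r • (σ : E3)) = F2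
  generalize dv F (r • (σ : E3)) = dF
  generalize hs0 : ((σ : E3) 0 : ℂ) = s0 at hs ⊢
  generalize hs1 : ((σ : E3) 1 : ℂ) = s1 at hs ⊢
  generalize hs2 : ((σ : E3) 2 : ℂ) = s2 at hs ⊢
  have hI := Complex.I_sq
  generalize conj U0 = U0'
  generalize conj D0 = D0'
  generalize conj D1 = D1'
  generalize conj D2 = D2'
  generalize conj (En k r) = e'
  generalize En k r = e
  generalize conj k = k'
  generalize Complex.I = ii at hI ⊢
  generalize (r : ℂ) = rr
  generalize (cS : ℂ) = c
  linear_combination (-(e*e'*(1-ii*k*rr)*(1+ii*k'*rr)*U0*U0')) * hs - k^2*rr^2*e*e'*U0*U0' * hI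

end
end

lemma cs_sph {a b : E3 → ℝ} (ha : Continuous a) (hb : Continuous b) (ha0 : ∀ x, 0 ≤ a x)
    (hb0 : ∀ x, 0 ≤ b x) :
    ∫ σ : sphere (0 : E3) 1, a σ * b σ ∂SS ≤
      Real.sqrt (∫ σ : sphere (0 : E3) 1, a σ ^ 2 ∂SS) * Real.sqrt (∫ σ : sphere (0 : E3) 1, b σ ^ 2 ∂SS) := by
  have hm : ∀ c : E3 → ℝ, Continuous c → MemLp (fun σ : sphere (0 : E3) 1 => c σ) (ENNReal.ofReal 2) SS := by
    intro c hc
    exact Continuous.memLp_of_hasCompactSupport (by fun_prop) (HasCompactSupport.of_compactSpace _)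
  have := integral_mul_le_Lp_mul_Lq_of_nonneg (μ := SS) (p := 2) (q := 2) Real.HolderConjugate.two_two
    (f := fun σ : sphere (0 : E3) 1 => a σ) (g := fun σ : sphere (0 : E3) 1 => b σ)
    (Filter.Eventually.of_forall fun σ => ha0 σ) (Filter.Eventually.of_forall fun σ => hb0 σ) (hm a ha) (hm b hb)
  simpa [Real.sqrt_eq_rpow] using this

/-- norm of a triple -/
noncomputable def n3 (v : Fin 3 → ℂ) : ℝ := Real.sqrt (∑ i, ‖v i‖ ^ 2)

lemma n3_nonneg (v : Fin 3 → ℂ) : 0 ≤ n3 v := Real.sqrt_nonneg _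
lemma n3_sq (v : Fin 3 → ℂ) : n3 v ^ 2 = ∑ i, ‖v i‖ ^ 2 :=
  Real.sq_sqrt (Finset.sum_nonneg fun i _ => by positivity)

lemma n3_cs (v w : Fin 3 → ℂ) : ‖∑ i, v i * w i‖ ≤ n3 v * n3 w := by
  refine (norm_sum_le _ _).trans ?_
  simp only [norm_mul]
  exact Real.sum_mul_le_sqrt_mul_sqrt _ _ _

lemma n3_sphere (σ : sphere (0 : E3) 1) : n3 (fun i => ((σ : E3) i : ℂ)) = 1 := by
  have h1 : ‖(σ : E3)‖ = 1 := by simp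
  rw [EuclideanSpace.norm_eq] at h1
  unfold n3
  simpa using h1

section
variable {k : ℂ} {u : E3 → ℂ} {F : Fin 3 → E3 → ℂ}

noncomputable def mQ (k : ℂ) (u : E3 → ℂ) (r : ℝ) : ℝ := ∫ σ : sphere (0 : E3) 1, ‖Mu k u r σ‖ ^ 2 ∂SS
noncomputable def eQ (k : ℂ) (u : E3 → ℂ) (r : ℝ) : ℝ :=
  ∫ σ : sphere (0 : E3) 1, n3 (fun i => Bb k u i r σ) ^ 2 ∂SS
noncomputable def nQ (k : ℂ) (F : Fin 3 → E3 → ℂ) (r : ℝ) : ℝ :=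
  r ^ 2 * ∫ σ : sphere (0 : E3) 1, n3 (fun i => fE k F i r σ) ^ 2 ∂SS
noncomputable def pQ (k : ℂ) (u : E3 → ℂ) (r : ℝ) : ℂ := ∫ σ : sphere (0 : E3) 1, Pd k u r σ ∂SS
noncomputable def qQ (k : ℂ) (u : E3 → ℂ) (F : Fin 3 → E3 → ℂ) (r : ℝ) : ℂ :=
  ∫ σ : sphere (0 : E3) 1, Qd k u F r σ ∂SS
noncomputable def sQ (k : ℂ) (u : E3 → ℂ) (F : Fin 3 → E3 → ℂ) (r : ℝ) : ℂ :=
  ∫ σ : sphere (0 : E3) 1, Sd k u F r σ ∂SS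

lemma n3_cont {α : Type*} [TopologicalSpace α] {v : Fin 3 → α → ℂ} (hv : ∀ i, Continuous (v i)) :
    Continuous fun x => n3 (fun i => v i x) := by
  unfold n3; fun_prop

lemma mQ_cont (hu : ContDiff ℝ 1 u) : Continuous (mQ k u) :=
  continuous_sph (H := fun r x => ‖Mu k u r x‖ ^ 2) ((Mu_cont hu).norm.pow 2)
lemma eQ_cont (hu : ContDiff ℝ 1 u) : Continuous (eQ k u) :=
  continuous_sph (H := fun r x => n3 (fun i => Bb k u i r x) ^ 2)
    ((n3_cont (v := fun i (z : ℝ × E3) => Bb k u i z.1 z.2) fun i => Bb_cont hu i).pow 2)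
lemma nQ_cont (hF : ∀ i, Continuous (F i)) : Continuous (nQ k F) :=
  (continuous_id.pow 2).mul <| continuous_sph (H := fun r x => n3 (fun i => fE k F i r x) ^ 2)
    ((n3_cont (v := fun i (z : ℝ × E3) => fE k F i z.1 z.2) fun i => fE_cont hF i).pow 2)
lemma pQ_cont (hu : ContDiff ℝ 1 u) : Continuous (pQ k u) :=
  continuous_sph (Pd_cont hu)
lemma qQ_cont (hu : ContDiff ℝ 1 u) (hF : ∀ i, Continuous (F i)) : Continuous (qQ k u F) :=
  continuous_sph (Qd_cont hu hF)
lemma sQ_cont (hu : ContDiff ℝ 1 u) (hF : ∀ i, Continuous (F i)) : Continuous (sQ k u F) :=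
  continuous_sph (Sd_cont hu hF)

lemma slice {G : Type*} [NormedAddCommGroup G] {H : ℝ → E3 → G}
    (hH : Continuous fun z : ℝ × E3 => H z.1 z.2) (r : ℝ) : Continuous (H r) :=
  hH.comp (by fun_prop : Continuous fun x : E3 => (r, x))

lemma mQ_hasDerivAt (hu : ContDiff ℝ 1 u) (r : ℝ) :
    HasDerivAt (mQ k u) (2 * (pQ k u r).re) r := by
  have h1 := m_hasDerivAt (k := k) hu r
  have h2 := Complex.reCLM.hasFDerivAt.comp_hasDerivAt r h1
  have e1 : ∀ r, mQ k u r =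
      (Complex.reCLM ∘ fun r => ∫ σ : sphere (0 : E3) 1, Mu k u r σ * conj (Mu k u r σ) ∂SS) r := by
    intro r
    have : ∀ σ : sphere (0 : E3) 1, Mu k u r σ * conj (Mu k u r σ) = ((‖Mu k u r σ‖ ^ 2 : ℝ) : ℂ) := by
      intro σ; rw [Complex.mul_conj, Complex.normSq_eq_norm_sq]
    simp only [Function.comp, this]
    rw [integral_complex_ofReal]
    simp [mQ]
  have e2 : mQ k u = _ := funext e1
  rw [e2]
  refine h2.congr_deriv ?_
  have hi : Integrable (fun σ : sphere (0 : E3) 1 => Pd k u r σ) SS := integrable_sph (slice (Pd_cont hu) r)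
  have hi2 : Integrable (fun σ : sphere (0 : E3) 1 => conj (Pd k u r σ)) SS :=
    integrable_sph (Complex.continuous_conj.comp (slice (Pd_cont hu) r))
  rw [integral_add hi hi2, integral_conj]
  simp [pQ]
  ring

lemma pq_hasDerivAt (hu : ContDiff ℝ 2 u) (hF : ∀ i, ContDiff ℝ 1 (F i))
    (hpde : ∀ x, dv (Du u) x + k ^ 2 * u x = - (cS : ℂ) *
      (dv F x - Complex.I * k * ∑ i, F i x * ((x i : ℂ) * (‖x‖ : ℂ)⁻¹)))
    {r : ℝ} (hr : 0 < r) :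
    HasDerivAt (fun r => pQ k u r + qQ k u F r)
      ((eQ k u r : ℂ) - 2 * Complex.I * k * pQ k u r + sQ k u F r) r := by
  have hu1 : ContDiff ℝ 1 u := hu.of_le (by norm_num)
  have hFc := fun i => (hF i).continuous
  have h := W_hasDerivAt hu hF hpde hr
  have hp : ∀ r, Integrable (fun σ : sphere (0 : E3) 1 => Pd k u r σ) SS := fun r =>
    integrable_sph (slice (Pd_cont hu1) r)
  have hq : ∀ r, Integrable (fun σ : sphere (0 : E3) 1 => Qd k u F r σ) SS := fun r =>
    integrable_sph (slice (Qd_cont hu1 hFc) r)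
  have hs : Integrable (fun σ : sphere (0 : E3) 1 => Sd k u F r σ) SS :=
    integrable_sph (slice (Sd_cont hu1 hFc) r)
  have he : Integrable (fun σ : sphere (0 : E3) 1 => Ed k u r σ) SS :=
    integrable_sph (slice (Ed_cont hu1) r)
  have e1 : (fun r => pQ k u r + qQ k u F r) =
      fun r => ∫ σ : sphere (0 : E3) 1, (Pd k u r σ + Qd k u F r σ) ∂SS := by
    funext r; rw [integral_add (hp r) (hq r)]; rfl
  rw [e1]
  refine h.congr_deriv ?_
  have hsub : Integrable (fun σ : sphere (0 : E3) 1 => Ed k u r σ - 2 * Complex.I * k * Pd k u r σ) SS :=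
    he.sub ((hp r).const_mul _)
  rw [integral_add hsub hs, integral_sub he ((hp r).const_mul _), integral_const_mul]
  have : ∫ σ : sphere (0 : E3) 1, Ed k u r σ ∂SS = (eQ k u r : ℂ) := by
    unfold eQ
    rw [← integral_complex_ofReal]
    refine integral_congr_ae (Filter.Eventually.of_forall fun σ => ?_)
    simp only [Ed, n3_sq]
    push_cast
    refine Finset.sum_congr rfl fun i _ => ?_
    rw [Complex.mul_conj, Complex.normSq_eq_norm_sq]
    push_cast; rfl
  rw [this]
  rfl

lemma Mu'_eq (r : ℝ) (σ : sphere (0 : E3) 1) :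
    Mu' k u r σ = ∑ i, ((σ : E3) i : ℂ) * Bb k u i r σ := by
  have hs := sphere_coord σ
  simp only [Fin.sum_univ_three] at hs
  simp only [Mu', Bb, Fin.sum_univ_three]
  linear_combination (-(En k r * (1 - Complex.I * k * r) * u (r • (σ : E3)))) * hs

lemma cS_nonneg : 0 ≤ cS := by
  unfold cS
  positivity

lemma eQ_nonneg (r : ℝ) : 0 ≤ eQ k u r := integral_nonneg fun σ => by positivity
lemma mQ_nonneg (r : ℝ) : 0 ≤ mQ k u r := integral_nonneg fun σ => by positivity
lemma nQ_nonneg (r : ℝ) : 0 ≤ nQ k F r :=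
  mul_nonneg (by positivity) (integral_nonneg fun σ => by positivity)

lemma pQ_le (hu : ContDiff ℝ 1 u) (r : ℝ) :
    ‖pQ k u r‖ ≤ Real.sqrt (eQ k u r) * Real.sqrt (mQ k u r) := by
  have hB : Continuous fun x : E3 => n3 (fun i => Bb k u i r x) :=
    n3_cont fun i => slice (Bb_cont hu i) r
  have hM : Continuous fun x : E3 => ‖Mu k u r x‖ := (slice (Mu_cont hu) r).norm
  refine le_trans ?_ (cs_sph hB hM (fun _ => n3_nonneg _) (fun _ => norm_nonneg _))
  refine norm_integral_le_of_norm_le (integrable_sph (hB.mul hM)) (Filter.Eventually.of_forall fun σ => ?_)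
  rw [Pd, norm_mul, RCLike.norm_conj, Mu'_eq]
  refine mul_le_mul_of_nonneg_right ?_ (norm_nonneg _)
  refine (n3_cs _ _).trans ?_
  rw [n3_sphere, one_mul]

lemma nQ_sqrt {r : ℝ} (hr : 0 ≤ r) : Real.sqrt (nQ k F r) =
    r * Real.sqrt (∫ σ : sphere (0 : E3) 1, n3 (fun i => fE k F i r σ) ^ 2 ∂SS) := by
  unfold nQ
  rw [Real.sqrt_mul (by positivity), Real.sqrt_sq hr]

lemma qQ_le (hu : ContDiff ℝ 1 u) (hF : ∀ i, Continuous (F i)) {r : ℝ} (hr : 0 ≤ r) :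
    ‖qQ k u F r‖ ≤ cS * (Real.sqrt (nQ k F r) * Real.sqrt (mQ k u r)) := by
  have hB : Continuous fun x : E3 => n3 (fun i => fE k F i r x) :=
    n3_cont fun i => slice (fE_cont hF i) r
  have hM : Continuous fun x : E3 => ‖Mu k u r x‖ := (slice (Mu_cont hu) r).norm
  have h1 := cs_sph hB hM (fun _ => n3_nonneg _) (fun _ => norm_nonneg _)
  rw [nQ_sqrt hr]
  have h2 : ‖qQ k u F r‖ ≤ cS * r * ∫ σ : sphere (0 : E3) 1, n3 (fun i => fE k F i r σ) * ‖Mu k u r σ‖ ∂SS := by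
    rw [← integral_const_mul]
    refine norm_integral_le_of_norm_le ((integrable_sph (hB.mul hM)).const_mul _)
      (Filter.Eventually.of_forall fun σ => ?_)
    rw [Qd, norm_mul, norm_mul, norm_mul, RCLike.norm_conj, Complex.norm_real, Complex.norm_real,
      Real.norm_of_nonneg hr, Real.norm_of_nonneg cS_nonneg]
    have := n3_cs (fun i => ((σ : E3) i : ℂ)) (fun i => fE k F i r σ)
    rw [n3_sphere, one_mul] at this
    calc _ ≤ cS * (r * ‖Mu k u r σ‖ * n3 (fun i => fE k F i r σ)) := by
          have := cS_nonneg
          gcongr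
      _ = _ := by ring
  refine h2.trans ?_
  calc _ ≤ cS * r * _ := mul_le_mul_of_nonneg_left h1 (mul_nonneg cS_nonneg hr)
    _ = _ := by unfold mQ; ring

lemma sQ_le (hu : ContDiff ℝ 1 u) (hF : ∀ i, Continuous (F i)) {r : ℝ} (hr : 0 < r) :
    ‖sQ k u F r‖ ≤ cS * (Real.sqrt (nQ k F r) * (Real.sqrt (eQ k u r) + Real.sqrt (mQ k u r) / r)) := by
  have hf : Continuous fun x : E3 => n3 (fun i => fE k F i r x) :=
    n3_cont fun i => slice (fE_cont hF i) r
  have hB : Continuous fun x : E3 => n3 (fun i => Bb k u i r x) :=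
    n3_cont fun i => slice (Bb_cont hu i) r
  have hM : Continuous fun x : E3 => ‖Mu k u r x‖ := (slice (Mu_cont hu) r).norm
  have h1 := cs_sph hf hM (fun _ => n3_nonneg _) (fun _ => norm_nonneg _)
  have h1' := cs_sph hf hB (fun _ => n3_nonneg _) (fun _ => n3_nonneg _)
  rw [nQ_sqrt hr.le]
  have hi1 : Integrable (fun σ : sphere (0 : E3) 1 => n3 (fun i => fE k F i r σ) * ‖Mu k u r σ‖) SS :=
    integrable_sph (hf.mul hM)
  have hi2 : Integrable (fun σ : sphere (0 : E3) 1 => n3 (fun i => fE k F i r σ) * n3 (fun i => Bb k u i r σ)) SS :=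
    integrable_sph (hf.mul hB)
  have h2 : ‖sQ k u F r‖ ≤ cS * (r * (∫ σ : sphere (0 : E3) 1, n3 (fun i => fE k F i r σ) * n3 (fun i => Bb k u i r σ) ∂SS)
      + ∫ σ : sphere (0 : E3) 1, n3 (fun i => fE k F i r σ) * ‖Mu k u r σ‖ ∂SS) := by
    rw [← integral_const_mul, ← integral_add (hi2.const_mul _) hi1, ← integral_const_mul]
    refine norm_integral_le_of_norm_le (((hi2.const_mul _).add hi1).const_mul _)
      (Filter.Eventually.of_forall fun σ => ?_)
    rw [Sd, norm_mul, Complex.norm_real, Real.norm_of_nonneg cS_nonneg, Finset.sum_sub_distrib]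
    refine mul_le_mul_of_nonneg_left ?_ cS_nonneg
    refine (norm_sub_le _ _).trans ?_
    have a1 := n3_cs (fun i => fE k F i r σ) (fun i => conj (Bb k u i r σ))
    have a2 := n3_cs (fun i => ((σ : E3) i : ℂ)) (fun i => fE k F i r σ)
    rw [n3_sphere, one_mul] at a2
    have a3 : n3 (fun i => conj (Bb k u i r σ)) = n3 (fun i => Bb k u i r σ) := by
      simp [n3]
    rw [a3] at a1
    simp only [mul_assoc]
    rw [← Finset.mul_sum]
    simp only [← mul_assoc]
    rw [← Finset.sum_mul, norm_mul, norm_mul, RCLike.norm_conj, Complex.norm_real, Real.norm_of_nonneg hr.le]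
    simp only [mul_assoc]
    gcongr
  refine h2.trans ?_
  have h3 := mul_le_mul_of_nonneg_left h1' hr.le
  calc _ ≤ cS * (r * _ + _) := mul_le_mul_of_nonneg_left (add_le_add h3 h1) cS_nonneg
    _ = _ := by unfold mQ eQ; field_simp

end

lemma cs_int {a b : ℝ → ℝ} (ha : Continuous a) (hb : Continuous b) (ha0 : ∀ x, 0 ≤ a x)
    (hb0 : ∀ x, 0 ≤ b x) {R R' : ℝ} (h : R ≤ R') :
    ∫ r in R..R', a r * b r ≤ Real.sqrt (∫ r in R..R', a r ^ 2) * Real.sqrt (∫ r in R..R', b r ^ 2) := by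
  simp only [intervalIntegral.integral_of_le h]
  have hm : ∀ c : ℝ → ℝ, Continuous c →
      MemLp c (ENNReal.ofReal 2) (volume.restrict (Set.Ioc R R')) := by
    intro c hc
    have h1 : MemLp c 2 (volume.restrict (Set.Ioc R R')) := by
      rw [memLp_two_iff_integrable_sq hc.aestronglyMeasurable]
      exact (hc.pow 2).integrableOn_Ioc
    simpa using h1
  have := integral_mul_le_Lp_mul_Lq_of_nonneg (μ := volume.restrict (Set.Ioc R R')) (p := 2) (q := 2)
    Real.HolderConjugate.two_two (f := a) (g := b)
    (Filter.Eventually.of_forall fun σ => ha0 σ) (Filter.Eventually.of_forall fun σ => hb0 σ) (hm a ha) (hm b hb)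
  simpa [Real.sqrt_eq_rpow] using this

/-- Data of the one dimensional energy argument. -/
structure OneD (k : ℂ) (c N : ℝ) (m e n : ℝ → ℝ) (p q s : ℝ → ℂ) : Prop where
  hk : 0 < k.im
  hc : 0 ≤ c
  hN : 0 ≤ N
  mc : Continuous m
  ec : Continuous e
  nc : Continuous n
  pc : Continuous p
  qc : Continuous q
  sc : Continuous s
  m0 : ∀ r, 0 ≤ m r
  e0 : ∀ r, 0 ≤ e r
  n0 : ∀ r, 0 ≤ n r
  mz : m 0 = 0
  dm : ∀ r, HasDerivAt m (2 * (p r).re) r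
  dpq : ∀ r, 0 < r → HasDerivAt (fun r => p r + q r) ((e r : ℂ) - 2 * Complex.I * k * p r + s r) r
  bp : ∀ r, 0 ≤ r → ‖p r‖ ≤ √(e r) * √(m r)
  bq : ∀ r, 0 ≤ r → ‖q r‖ ≤ c * (√(n r) * √(m r))
  bs : ∀ r, 0 < r → ‖s r‖ ≤ c * (√(n r) * (√(e r) + √(m r) / r))
  nz : ∃ ρ : ℝ, 0 < ρ ∧ ∀ r, |r| < ρ → n r = 0
  nR : ∃ R : ℝ, 0 < R ∧ ∀ r, R < r → n r = 0
  nN : ∀ R, 0 < R → ∫ r in (0 : ℝ)..R, n r * (max 1 r / r) ^ 2 ≤ N ^ 2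

namespace OneD
variable {k : ℂ} {c N : ℝ} {m e n : ℝ → ℝ} {p q s : ℝ → ℂ}

lemma wcont (h : OneD k c N m e n p q s) : Continuous fun r => √(n r) * (max 1 r / r) := by
  obtain ⟨ρ, hρ, hz⟩ := h.nz
  rw [continuous_iff_continuousAt]
  intro r
  by_cases hr : r = 0
  · subst hr
    have : (fun r => √(n r) * (max 1 r / r)) =ᶠ[nhds 0] fun _ => 0 := by
      have h1 : ∀ᶠ r : ℝ in nhds 0, |r| < ρ := by
        have := Metric.ball_mem_nhds (0 : ℝ) hρ
        filter_upwards [this] with r hr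
        simpa using hr
      filter_upwards [h1] with r hr
      simp [hz r hr]
    exact continuousAt_const.congr this.symm
  · have h1 := h.nc
    have h2 : ContinuousAt (fun r : ℝ => max 1 r / r) r :=
      ContinuousAt.div (by fun_prop) continuousAt_id hr
    exact (h1.sqrt.continuousAt).mul h2

lemma intN (h : OneD k c N m e n p q s) {R R' : ℝ} (hR : 0 ≤ R) (hRR : R ≤ R') :
    ∫ r in R..R', n r ≤ N ^ 2 := by
  rcases hRR.eq_or_lt with h1 | h1
  · rw [h1]; simp; positivity [h.hN]
  have hi : ∀ a b : ℝ, IntervalIntegrable n volume a b := fun a b => h.nc.intervalIntegrable a b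
  have e1 : ∫ r in R..R', n r ≤ ∫ r in (0:ℝ)..R', n r := by
    rw [← intervalIntegral.integral_add_adjacent_intervals (hi 0 R) (hi R R')]
    have := intervalIntegral.integral_nonneg (μ := volume) hR (fun r _ => h.n0 r)
    linarith
  refine e1.trans (le_trans ?_ (h.nN R' (by linarith)))
  have e2 : (fun r => n r * (max 1 r / r) ^ 2) = fun r => (√(n r) * (max 1 r / r)) ^ 2 := by
    funext r; rw [mul_pow, Real.sq_sqrt (h.n0 r)]
  refine intervalIntegral.integral_mono_on_of_le_Ioo (by linarith) (hi 0 R') ?_ ?_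
  · rw [e2]; exact (h.wcont.pow 2).intervalIntegrable _ _
  · intro r hr
    refine le_mul_of_one_le_right (h.n0 r) ?_
    have : 1 ≤ max 1 r / r := by
      rw [le_div_iff₀ hr.1, one_mul]; exact le_max_right _ _
    nlinarith

lemma int_inv {R : ℝ} (hR : 0 < R) : ∫ r in (0 : ℝ)..R, (1 / max 1 r) ^ 2 ≤ 2 := by
  have hc : Continuous fun r : ℝ => (1 / max 1 r) ^ 2 := by
    refine Continuous.pow (Continuous.div continuous_const (by fun_prop) fun r => ?_) 2
    have : (1:ℝ) ≤ max 1 r := le_max_left _ _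
    linarith
  have hi : ∀ a b : ℝ, IntervalIntegrable (fun r : ℝ => (1 / max 1 r) ^ 2) volume a b :=
    fun a b => hc.intervalIntegrable a b
  have hmono : ∫ r in (0 : ℝ)..R, (1 / max 1 r) ^ 2 ≤ ∫ r in (0 : ℝ)..(max 1 R), (1 / max 1 r) ^ 2 := by
    rw [← intervalIntegral.integral_add_adjacent_intervals (hi 0 R) (hi R (max 1 R))]
    have := intervalIntegral.integral_nonneg (μ := volume) (le_max_right 1 R)
      (fun r _ => (by positivity : 0 ≤ (1 / max 1 r) ^ 2))
    linarith
  refine hmono.trans ?_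
  rw [← intervalIntegral.integral_add_adjacent_intervals (hi 0 1) (hi 1 (max 1 R))]
  have h1 : ∫ r in (0 : ℝ)..1, (1 / max 1 r) ^ 2 = 1 := by
    have : ∫ r in (0 : ℝ)..1, (1 / max 1 r) ^ 2 = ∫ r in (0 : ℝ)..1, (1 : ℝ) := by
      refine intervalIntegral.integral_congr fun r hr => ?_
      rw [Set.uIcc_of_le zero_le_one] at hr
      beta_reduce
      rw [max_eq_left hr.2]; norm_num
    rw [this]; simp
  have h2 : ∫ r in (1 : ℝ)..(max 1 R), (1 / max 1 r) ^ 2 ≤ 1 := by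
    have h3 : ∀ r ∈ Set.uIcc (1:ℝ) (max 1 R), HasDerivAt (fun r : ℝ => - r⁻¹) ((1 / max 1 r) ^ 2) r := by
      intro r hr
      rw [Set.uIcc_of_le (le_max_left _ _)] at hr
      have hr0 : r ≠ 0 := by linarith [hr.1]
      have := (hasDerivAt_inv hr0).neg
      refine HasDerivAt.congr_deriv (f := fun r : ℝ => - r⁻¹) this ?_
      rw [max_eq_right hr.1]; field_simp
    rw [intervalIntegral.integral_eq_sub_of_hasDerivAt h3 (hi _ _)]
    have : 0 ≤ (max 1 R)⁻¹ := by positivity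
    simp
  linarith

lemma int_sqrt_div (h : OneD k c N m e n p q s) {R : ℝ} (hR : 0 < R) :
    ∫ r in (0 : ℝ)..R, √(n r) / r ≤ 2 * N := by
  have hc : Continuous fun r : ℝ => (1 / max 1 r) := by
    refine (Continuous.div continuous_const (by fun_prop) fun r => ?_)
    have : (1:ℝ) ≤ max 1 r := le_max_left _ _
    linarith
  have ha : Continuous fun r => |√(n r) * (max 1 r / r)| := h.wcont.abs
  have h1 := cs_int ha hc (fun r => abs_nonneg _) (fun r => by positivity) hR.le
  have e1 : ∫ r in (0 : ℝ)..R, √(n r) / r = ∫ r in (0 : ℝ)..R, |√(n r) * (max 1 r / r)| * (1 / max 1 r) := by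
    refine intervalIntegral.integral_congr fun r hr => ?_
    rw [Set.uIcc_of_le hR.le] at hr
    have h1 : (1:ℝ) ≤ max 1 r := le_max_left _ _
    have h0 := hr.1
    beta_reduce
    rw [abs_of_nonneg (by positivity)]
    field_simp
  have e2 : ∫ r in (0 : ℝ)..R, |√(n r) * (max 1 r / r)| ^ 2 ≤ N ^ 2 := by
    have : (fun r => |√(n r) * (max 1 r / r)| ^ 2) = fun r => n r * (max 1 r / r) ^ 2 := by
      funext r; rw [sq_abs, mul_pow, Real.sq_sqrt (h.n0 r)]
    rw [this]; exact h.nN R hR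
  rw [e1]
  refine h1.trans ?_
  have h3 : √(∫ r in (0 : ℝ)..R, |√(n r) * (max 1 r / r)| ^ 2) ≤ N := by
    rw [Real.sqrt_le_left h.hN]; exact e2
  have h4 : √(∫ r in (0 : ℝ)..R, (1 / max 1 r) ^ 2) ≤ 2 := by
    rw [Real.sqrt_le_left (by norm_num)]
    exact (int_inv hR).trans (by norm_num)
  rw [mul_comm 2 N]
  exact mul_le_mul h3 h4 (Real.sqrt_nonneg _) h.hN

lemma pz (h : OneD k c N m e n p q s) : p 0 = 0 ∧ q 0 = 0 := by
  have h1 := h.bp 0 le_rfl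
  have h2 := h.bq 0 le_rfl
  rw [h.mz] at h1 h2
  simp at h1 h2
  exact ⟨h1, h2⟩

lemma star (h : OneD k c N m e n p q s) {M : ℝ} (hM : 0 < M) (hmM : ∀ r, 0 ≤ r → m r ≤ M ^ 2)
    {R : ℝ} (hR : 0 < R) :
    k.im * (∫ r in (0 : ℝ)..R, e r) + ‖k‖ ^ 2 * m R ≤
      ‖k‖ * (‖p R‖ + ‖q R‖ + c * N * √(∫ r in (0 : ℝ)..R, e r) + 2 * c * N * M) := by
  obtain ⟨hp0, hq0⟩ := h.pz
  set Φ : ℝ → ℝ := fun r => (Complex.I * conj k * (p r + q r)).re - ‖k‖ ^ 2 * m r with hΦ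
  have hd : ∀ r ∈ Set.Ioo 0 R, HasDerivAt Φ (k.im * e r + (Complex.I * conj k * s r).re) r := by
    intro r hr
    have h1 := (h.dpq r hr.1).const_mul (Complex.I * conj k)
    have h2 := Complex.reCLM.hasFDerivAt.comp_hasDerivAt r h1
    have h3 := h2.sub ((h.dm r).const_mul (‖k‖ ^ 2))
    refine HasDerivAt.congr_deriv (f := Φ) h3 ?_
    rw [← Complex.normSq_eq_norm_sq, Complex.normSq_apply]
    simp
    ring
  have hcont : Continuous Φ := by
    have h1 := h.pc
    have h2 := h.qc
    have h3 := h.mc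
    simp only [hΦ]
    fun_prop
  have hec := h.ec
  have hsc := h.sc
  have hi : Continuous fun r => k.im * e r + (Complex.I * conj k * s r).re := by fun_prop
  have hftc := intervalIntegral.integral_eq_sub_of_hasDerivAt_of_le hR.le hcont.continuousOn hd
    (hi.intervalIntegrable _ _)
  have hs1 : Continuous fun r => (Complex.I * conj k * s r).re := by fun_prop
  rw [intervalIntegral.integral_add ((hec.const_mul _).intervalIntegrable _ _) (hs1.intervalIntegrable _ _),
    intervalIntegral.integral_const_mul] at hftc
  have hΦ0 : Φ 0 = 0 := by simp [hΦ, hp0, hq0, h.mz]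
  rw [hΦ0, sub_zero] at hftc
  have hΦR : Φ R ≤ ‖k‖ * (‖p R‖ + ‖q R‖) - ‖k‖ ^ 2 * m R := by
    simp only [hΦ]
    have : (Complex.I * conj k * (p R + q R)).re ≤ ‖k‖ * (‖p R‖ + ‖q R‖) := by
      refine (Complex.re_le_norm _).trans ?_
      rw [norm_mul, norm_mul, Complex.norm_I, one_mul, RCLike.norm_conj]
      exact mul_le_mul_of_nonneg_left (norm_add_le _ _) (norm_nonneg _)
    linarith
  -- bound of the source term
  have hnc := h.nc
  have g1 : Continuous fun r => √(n r) * √(e r) := by fun_prop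
  have g2 : Continuous fun r => √(n r) / r := by
    have hmax : Continuous fun r : ℝ => (1 / max 1 r) := by
      refine (Continuous.div continuous_const (by fun_prop) fun r => ?_)
      have : (1:ℝ) ≤ max 1 r := le_max_left _ _
      linarith
    have := h.wcont.mul hmax
    refine this.congr fun r => ?_
    have h1 : (1:ℝ) ≤ max 1 r := le_max_left _ _
    have h2 : max 1 r ≠ 0 := by linarith
    simp only [Pi.mul_apply]
    rw [mul_assoc, div_mul_div_comm, mul_one, mul_comm r, ← div_div, div_self h2]
    ring
  have hsb : ∫ r in (0 : ℝ)..R, -(Complex.I * conj k * s r).re ≤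
      ∫ r in (0 : ℝ)..R, ‖k‖ * (c * (√(n r) * √(e r)) + c * M * (√(n r) / r)) := by
    refine intervalIntegral.integral_mono_on_of_le_Ioo hR.le (hs1.neg.intervalIntegrable _ _) ?_ ?_
    · exact (((g1.const_mul c).add (g2.const_mul (c * M))).const_mul _).intervalIntegrable _ _
    · intro r hr
      have a1 : -(Complex.I * conj k * s r).re ≤ ‖k‖ * ‖s r‖ := by
        have := Complex.re_le_norm (-(Complex.I * conj k * s r))
        rw [norm_neg, norm_mul, norm_mul, Complex.norm_I, one_mul, RCLike.norm_conj, Complex.neg_re] at this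
        exact this
      refine a1.trans (mul_le_mul_of_nonneg_left ((h.bs r hr.1).trans ?_) (norm_nonneg _))
      have a2 : √(m r) ≤ M := by
        rw [Real.sqrt_le_left hM.le]; exact hmM r hr.1.le
      have hr0 := hr.1
      have hc := h.hc
      calc c * (√(n r) * (√(e r) + √(m r) / r)) ≤ c * (√(n r) * (√(e r) + M / r)) := by gcongr
        _ = _ := by ring
  rw [intervalIntegral.integral_neg, intervalIntegral.integral_const_mul, intervalIntegral.integral_add
    ((g1.const_mul c).intervalIntegrable _ _) ((g2.const_mul (c * M)).intervalIntegrable _ _),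
    intervalIntegral.integral_const_mul, intervalIntegral.integral_const_mul] at hsb
  have b1 : ∫ r in (0 : ℝ)..R, √(n r) * √(e r) ≤ N * √(∫ r in (0 : ℝ)..R, e r) := by
    refine (cs_int (by fun_prop) (by fun_prop) (fun r => Real.sqrt_nonneg _) (fun r => Real.sqrt_nonneg _) hR.le).trans ?_
    simp only [Real.sq_sqrt (h.n0 _), Real.sq_sqrt (h.e0 _)]
    refine mul_le_mul_of_nonneg_right ?_ (Real.sqrt_nonneg _)
    rw [Real.sqrt_le_left h.hN]
    exact h.intN le_rfl hR.le
  have b2 := h.int_sqrt_div hR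
  have hc := h.hc
  have b3 : ‖k‖ * (c * (∫ r in (0 : ℝ)..R, √(n r) * √(e r)) + c * M * ∫ r in (0 : ℝ)..R, √(n r) / r) ≤
     ‖k‖ * (c * (N * √(∫ r in (0 : ℝ)..R, e r)) + c * M * (2 * N)) := by gcongr
  nlinarith [hftc, hΦR, hsb, b3]

end OneD

namespace OneD
variable {k : ℂ} {c N : ℝ} {m e n : ℝ → ℝ} {p q s : ℝ → ℂ}

lemma Emono (h : OneD k c N m e n p q s) {R R' : ℝ} (hRR : R ≤ R') :
    ∫ r in (0 : ℝ)..R, e r ≤ ∫ r in (0 : ℝ)..R', e r := by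
  have hi : ∀ a b : ℝ, IntervalIntegrable e volume a b := fun a b => h.ec.intervalIntegrable a b
  rw [← intervalIntegral.integral_add_adjacent_intervals (hi 0 R) (hi R R')]
  have := intervalIntegral.integral_nonneg (μ := volume) hRR (fun r _ => h.e0 r)
  linarith

lemma kpos (h : OneD k c N m e n p q s) : 0 < ‖k‖ := by
  have := h.hk
  have h2 : k ≠ 0 := by rintro rfl; simp at this
  exact norm_pos_iff.2 h2

lemma im_le (h : OneD k c N m e n p q s) : k.im ≤ ‖k‖ := (le_abs_self _).trans (Complex.abs_im_le_norm k)

lemma step1 (h : OneD k c N m e n p q s) {M : ℝ} (hM : 0 < M) (hmM : ∀ r, 0 ≤ r → m r ≤ M ^ 2)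
    {R1 : ℝ} (hR1 : 0 < R1) :
    ∫ r in (0 : ℝ)..R1, e r ≤ 16 * ‖k‖ ^ 2 * c ^ 2 * N ^ 2 / k.im ^ 2 + 8 * ‖k‖ * c * N * M / k.im := by
  by_contra! hlt
  obtain ⟨R0, hR0, hn⟩ := h.nR
  set E : ℝ → ℝ := fun R => ∫ r in (0 : ℝ)..R, e r with hE
  set R2 := max R1 (R0 + 1) with hR2
  have hk := h.hk
  have hk0 := h.kpos
  have hc := h.hc
  have hN := h.hN
  set A := 16 * ‖k‖ ^ 2 * c ^ 2 * N ^ 2 / k.im ^ 2 + 8 * ‖k‖ * c * N * M / k.im with hA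
  have hA0 : 0 ≤ A := by positivity
  have hEA : ∀ R, R2 ≤ R → A < E R := fun R hR =>
    hlt.trans_le (h.Emono ((le_max_left _ _).trans hR))
  set κ := (k.im / (2 * ‖k‖ * M)) ^ 2 with hκ
  have hκ0 : 0 < κ := by positivity
  have key : ∀ R, R2 ≤ R → κ * E R ^ 2 ≤ e R := by
    intro R hR
    have hRp : 0 < R := hR1.trans_le ((le_max_left _ _).trans hR)
    have hRn : n R = 0 := hn R (by have := (le_max_right R1 (R0+1)).trans hR; linarith)
    have hq : ‖q R‖ = 0 := by
      have := h.bq R hRp.le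
      rw [hRn] at this
      simp at this
      simp [this]
    have hst := h.star hM hmM hRp
    have hp := h.bp R hRp.le
    have hm : √(m R) ≤ M := by rw [Real.sqrt_le_left hM.le]; exact hmM R hRp.le
    have hEp : 0 < E R := hA0.trans_lt (hEA R hR)
    have x1 : 8 * ‖k‖ * c * N * M / k.im ≤ E R := by
      have : 0 ≤ 16 * ‖k‖ ^ 2 * c ^ 2 * N ^ 2 / k.im ^ 2 := by positivity
      linarith [hEA R hR]
    have x2 : 16 * ‖k‖ ^ 2 * c ^ 2 * N ^ 2 / k.im ^ 2 ≤ E R := by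
      have : 0 ≤ 8 * ‖k‖ * c * N * M / k.im := by positivity
      linarith [hEA R hR]
    have x3 : 4 * ‖k‖ * c * N / k.im ≤ √(E R) := by
      apply Real.le_sqrt_of_sq_le
      calc _ = _ := by ring
        _ ≤ _ := x2
    rw [div_le_iff₀ hk] at x1 x3
    have hsE : √(E R) * √(E R) = E R := Real.mul_self_sqrt hEp.le
    have hs0 := Real.sqrt_nonneg (E R)
    have hp' : ‖p R‖ ≤ √(e R) * M := hp.trans (by gcongr)
    have hm0 := h.m0 R
    have y1 : ‖k‖ * (c * N * √(E R)) ≤ k.im * E R / 4 := by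
      nlinarith
    have y2 : k.im * E R ≤ ‖k‖ * (√(e R) * M + c * N * √(E R) + 2 * c * N * M) := by
      have : 0 ≤ ‖k‖ ^ 2 * m R := by positivity
      have h3 : ‖k‖ * (‖p R‖ + ‖q R‖ + c * N * √(E R) + 2 * c * N * M) ≤
        ‖k‖ * (√(e R) * M + c * N * √(E R) + 2 * c * N * M) := by
        rw [hq]; gcongr; linarith
      simp only [hE] at h3 ⊢
      linarith
    have y3 : k.im * E R / (2 * ‖k‖ * M) ≤ √(e R) := by
      rw [div_le_iff₀ (by positivity)]
      linarith
    have y4 := Real.le_sqrt' (x := k.im * E R / (2 * ‖k‖ * M)) (y := e R) (by positivity)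
    have y5 := y4.1 y3
    calc _ = _ := by rw [hκ]; ring
      _ ≤ _ := y5
  have hEd : ∀ r, HasDerivAt E (e r) r := fun r =>
    intervalIntegral.integral_hasDerivAt_right (h.ec.intervalIntegrable _ _)
      (h.ec.stronglyMeasurableAtFilter _ _) h.ec.continuousAt
  have hEp : ∀ R, R2 ≤ R → 0 < E R := fun R hR => hA0.trans_lt (hEA R hR)
  have hGd : ∀ r, R2 ≤ r → HasDerivAt (fun r => (E r)⁻¹ + κ * r) (-(e r) / E r ^ 2 + κ * 1) r := fun r hr =>
    ((hEd r).inv (hEp r hr).ne').add ((hasDerivAt_id r).const_mul κ)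
  have hanti : AntitoneOn (fun r => (E r)⁻¹ + κ * r) (Set.Ici R2) := by
    refine antitoneOn_of_deriv_nonpos (convex_Ici _) (fun r hr => (hGd r hr).continuousAt.continuousWithinAt)
      (fun r hr => (hGd r (interior_subset hr)).differentiableAt.differentiableWithinAt) fun r hr => ?_
    have hr' := interior_subset hr
    rw [(hGd r hr').deriv]
    have := key r hr'
    have h2 : κ ≤ e r / E r ^ 2 := by
      rw [le_div_iff₀ (by have := hEp r hr'; positivity)]; exact this
    rw [neg_div]; linarith
  have hE2 := hEp R2 le_rfl
  set r3 := R2 + (E R2)⁻¹ / κ + 1 with hr3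
  have hge : R2 ≤ r3 := by
    have : 0 ≤ (E R2)⁻¹ / κ := by positivity
    linarith
  have := hanti (Set.self_mem_Ici) hge hge
  have h4 := hEp r3 hge
  have h5 : 0 < (E r3)⁻¹ := by positivity
  have h6 : κ * r3 = κ * R2 + (E R2)⁻¹ + κ := by
    rw [hr3]; field_simp
  simp only at this
  linarith

lemma step2 (h : OneD k c N m e n p q s) {M A : ℝ} (hM : 0 < M) (hmM : ∀ r, 0 ≤ r → m r ≤ M ^ 2)
    (hA : 0 ≤ A) (hE : ∀ R, 0 < R → ∫ r in (0 : ℝ)..R, e r ≤ A) {R : ℝ} (hR : 0 < R) :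
    m R ≤ 3 * M * √(A / ‖k‖) + c * M * N / √‖k‖ + (c * N * √A + 2 * c * N * M) / ‖k‖ := by
  have hk := h.hk
  have hk0 := h.kpos
  have hc := h.hc
  have hN := h.hN
  have hec := h.ec
  have hnc := h.nc
  have hpc := h.pc
  set δ := 1 / ‖k‖ with hδ
  have hδ0 : 0 < δ := by positivity
  have hi : ∀ a b : ℝ, IntervalIntegrable e volume a b := fun a b => h.ec.intervalIntegrable a b
  have hloc : ∀ r, R ≤ r → ∫ t in R..r, e t ≤ A := by
    intro r hr
    have h1 := hE r (by linarith)
    rw [← intervalIntegral.integral_add_adjacent_intervals (hi 0 R) (hi R r)] at h1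
    have := intervalIntegral.integral_nonneg (μ := volume) hR.le (fun r _ => h.e0 r)
    linarith
  have hse : ∀ r, R ≤ r → r ≤ R + δ → ∫ t in R..r, √(e t) ≤ √(A * δ) := by
    intro r hr hr'
    have h1 := cs_int (a := fun t => √(e t)) (b := fun _ => 1) (by fun_prop) (by fun_prop)
      (fun r => Real.sqrt_nonneg _) (fun r => zero_le_one) hr
    simp only [Real.sq_sqrt (h.e0 _), mul_one, one_pow, intervalIntegral.integral_const, smul_eq_mul] at h1
    refine h1.trans ?_
    rw [Real.sqrt_mul hA]
    have := hloc r hr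
    gcongr
    linarith
  have hsn : ∫ t in R..(R + δ), √(n t) ≤ N * √δ := by
    have h1 := cs_int (a := fun t => √(n t)) (b := fun _ => 1) (by fun_prop) (by fun_prop)
      (fun r => Real.sqrt_nonneg _) (fun r => zero_le_one) (by linarith : R ≤ R + δ)
    simp only [Real.sq_sqrt (h.n0 _), mul_one, one_pow, intervalIntegral.integral_const, smul_eq_mul,
      add_sub_cancel_left] at h1
    refine h1.trans ?_
    gcongr
    rw [Real.sqrt_le_left hN]
    exact h.intN hR.le (by linarith)
  have hsm : ∀ r, 0 ≤ r → √(m r) ≤ M := fun r hr => by rw [Real.sqrt_le_left hM.le]; exact hmM r hr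
  have hmr : ∀ r, R ≤ r → r ≤ R + δ → m R ≤ m r + 2 * M * √(A * δ) := by
    intro r hr hr'
    have h1 := intervalIntegral.integral_eq_sub_of_hasDerivAt (a := R) (b := r) (fun t _ => h.dm t)
      (Continuous.intervalIntegrable (by fun_prop) _ _)
    have h2 : ∫ t in R..r, -(2 * M * √(e t)) ≤ ∫ t in R..r, 2 * (p t).re := by
      refine intervalIntegral.integral_mono_on hr (Continuous.intervalIntegrable (by fun_prop) _ _)
        (Continuous.intervalIntegrable (by fun_prop) _ _) fun t ht => ?_
      have ht0 : 0 ≤ t := by linarith [ht.1]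
      have a1 := (abs_le.1 ((Complex.abs_re_le_norm (p t)).trans (h.bp t ht0))).1
      have a2 := hsm t ht0
      have a3 : √(e t) * √(m t) ≤ √(e t) * M := by gcongr
      linarith
    rw [intervalIntegral.integral_neg, intervalIntegral.integral_const_mul, h1] at h2
    have h3 : 2 * M * (∫ t in R..r, √(e t)) ≤ 2 * M * √(A * δ) := by
      have := hse r hr hr'
      gcongr
    linarith
  have hst : ∀ r, R ≤ r → r ≤ R + δ → m R ≤ 2 * M * √(A * δ) + (c * N * √A + 2 * c * N * M) / ‖k‖
      + M / ‖k‖ * √(e r) + c * M / ‖k‖ * √(n r) := by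
    intro r hr hr'
    have hr0 : 0 < r := by linarith
    have h1 := h.star hM hmM hr0
    have h2 := h.bp r hr0.le
    have h3 := h.bq r hr0.le
    have h4 := hsm r hr0.le
    have h5 : √(∫ t in (0:ℝ)..r, e t) ≤ √A := Real.sqrt_le_sqrt (hE r hr0)
    have h6 : ‖k‖ * (‖p r‖ + ‖q r‖ + c * N * √(∫ t in (0:ℝ)..r, e t) + 2 * c * N * M) ≤
       ‖k‖ * (√(e r) * M + c * (√(n r) * M) + c * N * √A + 2 * c * N * M) := by
      have h2' : ‖p r‖ ≤ √(e r) * M := h2.trans (by gcongr)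
      have h3' : ‖q r‖ ≤ c * (√(n r) * M) := h3.trans (by gcongr)
      gcongr
    have h7 : 0 ≤ k.im * ∫ t in (0:ℝ)..r, e t :=
      mul_nonneg hk.le (intervalIntegral.integral_nonneg hr0.le (fun r _ => h.e0 r))
    have h8 : ‖k‖ * (‖k‖ * m r) ≤ ‖k‖ * (√(e r) * M + c * (√(n r) * M) + c * N * √A + 2 * c * N * M) := by
      nlinarith
    have h9 := le_of_mul_le_mul_left h8 hk0
    have h10 : m r ≤ (√(e r) * M + c * (√(n r) * M) + c * N * √A + 2 * c * N * M) / ‖k‖ := by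
      rw [le_div_iff₀ hk0]; linarith
    have h11 := hmr r hr hr'
    calc m R ≤ _ := h11
      _ ≤ (√(e r) * M + c * (√(n r) * M) + c * N * √A + 2 * c * N * M) / ‖k‖ + 2 * M * √(A * δ) := by linarith
      _ = _ := by ring
  have hIntg : ∫ r in R..(R + δ), m R ≤ ∫ r in R..(R + δ), (2 * M * √(A * δ) + (c * N * √A + 2 * c * N * M) / ‖k‖
      + M / ‖k‖ * √(e r) + c * M / ‖k‖ * √(n r)) := by
    refine intervalIntegral.integral_mono_on (by linarith) (Continuous.intervalIntegrable (by fun_prop) _ _)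
        (Continuous.intervalIntegrable (by fun_prop) _ _) fun t ht => hst t ht.1 ht.2
  rw [intervalIntegral.integral_add (Continuous.intervalIntegrable (by fun_prop) _ _)
      (Continuous.intervalIntegrable (by fun_prop) _ _),
    intervalIntegral.integral_add (Continuous.intervalIntegrable (by fun_prop) _ _)
      (Continuous.intervalIntegrable (by fun_prop) _ _),
    intervalIntegral.integral_const_mul, intervalIntegral.integral_const_mul] at hIntg
  simp only [intervalIntegral.integral_const, smul_eq_mul, add_sub_cancel_left] at hIntg
  have f1 : M / ‖k‖ * ∫ t in R..(R + δ), √(e t) ≤ M / ‖k‖ * √(A * δ) := by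
    have := hse (R + δ) (by linarith) le_rfl
    gcongr
  have f2 : c * M / ‖k‖ * ∫ t in R..(R + δ), √(n t) ≤ c * M / ‖k‖ * (N * √δ) := by gcongr
  have f3 : δ * m R ≤ δ * (3 * M * √(A * δ) + c * M * N * √δ + (c * N * √A + 2 * c * N * M) / ‖k‖) := by
    calc δ * m R ≤ _ := hIntg
      _ ≤ δ * (2 * M * √(A * δ) + (c * N * √A + 2 * c * N * M) / ‖k‖) + M / ‖k‖ * √(A * δ) + c * M / ‖k‖ * (N * √δ) := by
        linarith
      _ = _ := by rw [div_eq_mul_one_div M, div_eq_mul_one_div (c * M), ← hδ]; ring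
  have f4 := le_of_mul_le_mul_left f3 hδ0
  have g1 : A * δ = A / ‖k‖ := by rw [hδ]; ring
  have g2 : √δ = 1 / √‖k‖ := by rw [hδ]; simp
  rw [g1, g2] at f4
  calc _ ≤ _ := f4
    _ = _ := by ring

lemma amgm (x y t : ℝ) (ht : 0 < t) : x * y ≤ x ^ 2 * t + y ^ 2 / (4 * t) := by
  have : 0 ≤ (2 * t * x - y) ^ 2 / (4 * t) := by positivity
  have e : (2 * t * x - y) ^ 2 / (4 * t) = x ^ 2 * t + y ^ 2 / (4 * t) - x * y := by field_simp; ring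
  linarith

lemma step3 (h : OneD k c N m e n p q s) {M : ℝ} (hM : 0 < M) (hmM : ∀ r, 0 ≤ r → m r ≤ M ^ 2)
    {R : ℝ} (hR : 0 < R) :
    m R ≤ M ^ 2 / 2 + 400000 * (c ^ 2 * N ^ 2 * (1 / ‖k‖ ^ 2 + 1 / k.im ^ 2 + ‖k‖ / k.im ^ 2 + 1 / k.im)) := by
  have hk := h.hk
  have hk0 := h.kpos
  have hc := h.hc
  have hN := h.hN
  have him := h.im_le
  set A := 16 * ‖k‖ ^ 2 * c ^ 2 * N ^ 2 / k.im ^ 2 + 8 * ‖k‖ * c * N * M / k.im with hA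
  have hA0 : 0 ≤ A := by positivity
  have h2 := h.step2 hM hmM hA0 (fun R hR => h.step1 hM hmM hR) hR
  set K := ‖k‖ with hK
  set η := k.im with hη
  have hAk : A / K = 16 * (c ^ 2 * N ^ 2 * (K / η ^ 2)) + 8 * (c * N * M / η) := by
    rw [hA]; field_simp
  have hinv : 1 / K ≤ 1 / η := one_div_le_one_div_of_le hk him
  have t1 : M * (3 * √(A / K)) ≤ M ^ 2 * (1 / 16) + (3 * √(A / K)) ^ 2 / (4 * (1 / 16)) := amgm _ _ _ (by norm_num)
  have t1' : (3 * √(A / K)) ^ 2 = 9 * (A / K) := by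
    rw [mul_pow, Real.sq_sqrt (by positivity)]; norm_num
  have t2 : M * (288 * (c * N / η)) ≤ M ^ 2 * (1 / 16) + (288 * (c * N / η)) ^ 2 / (4 * (1 / 16)) := amgm _ _ _ (by norm_num)
  have t2' : (288 * (c * N / η)) ^ 2 = 82944 * (c ^ 2 * N ^ 2 * (1 / η ^ 2)) := by ring
  have t3 : M * (c * N / √K) ≤ M ^ 2 * (1 / 16) + (c * N / √K) ^ 2 / (4 * (1 / 16)) := amgm _ _ _ (by norm_num)
  have t3' : (c * N / √K) ^ 2 = c ^ 2 * N ^ 2 * (1 / K) := by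
    rw [div_pow, Real.sq_sqrt hk0.le]; ring
  have t4 : (c * N / √K) * √(A / K) ≤ (c * N / √K) ^ 2 * (1 / 2) + √(A / K) ^ 2 / (4 * (1 / 2)) := amgm _ _ _ (by norm_num)
  have t4' : √(A / K) ^ 2 = A / K := Real.sq_sqrt (by positivity)
  have t4'' : c * N * √A / K = (c * N / √K) * √(A / K) := by
    rw [Real.sqrt_div hA0, div_mul_div_comm, Real.mul_self_sqrt hk0.le]
  have t5 : M * (4 * (c * N / η)) ≤ M ^ 2 * (1 / 16) + (4 * (c * N / η)) ^ 2 / (4 * (1 / 16)) := amgm _ _ _ (by norm_num)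
  have t5' : (4 * (c * N / η)) ^ 2 = 16 * (c ^ 2 * N ^ 2 * (1 / η ^ 2)) := by ring
  have t6 : M * (2 * (c * N / K)) ≤ M ^ 2 * (1 / 16) + (2 * (c * N / K)) ^ 2 / (4 * (1 / 16)) := amgm _ _ _ (by norm_num)
  have t6' : (2 * (c * N / K)) ^ 2 = 4 * (c ^ 2 * N ^ 2 * (1 / K ^ 2)) := by ring
  have hX : c * N * M / η = M * (c * N / η) := by ring
  have hinv' : c ^ 2 * N ^ 2 * (1 / K) ≤ c ^ 2 * N ^ 2 * (1 / η) := by gcongr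
  have p1 : 0 ≤ c ^ 2 * N ^ 2 * (1 / K ^ 2) := by positivity
  have p2 : 0 ≤ c ^ 2 * N ^ 2 * (1 / η ^ 2) := by positivity
  have p3 : 0 ≤ c ^ 2 * N ^ 2 * (K / η ^ 2) := by positivity
  have p4 : 0 ≤ c ^ 2 * N ^ 2 * (1 / η) := by positivity
  rw [hX] at hAk
  rw [t1'] at t1
  rw [t2'] at t2
  rw [t3'] at t3
  rw [t4', ← t4'', t3'] at t4
  rw [t5'] at t5
  rw [t6'] at t6
  have hfin : m R ≤ M * (3 * √(A / K)) + M * (c * N / √K) + c * N * √A / K + M * (2 * (c * N / K)) := by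
    calc m R ≤ _ := h2
      _ = _ := by ring
  have hM2 := mul_pos hM hM
  have d1 : (4 * (1 / 16) : ℝ) = 1 / 4 := by norm_num
  have d2 : (4 * (1 / 2) : ℝ) = 2 := by norm_num
  rw [d1] at t1 t2 t3 t5 t6
  rw [d2] at t4
  rw [mul_add (c ^ 2 * N ^ 2), mul_add (c ^ 2 * N ^ 2), mul_add (c ^ 2 * N ^ 2)]
  linarith

lemma step4 (h : OneD k c N m e n p q s) (hb : ∃ B, ∀ r, 0 ≤ r → m r ≤ B) {R : ℝ} (hR : 0 ≤ R) :
    m R ≤ 800000 * (c ^ 2 * N ^ 2 * (1 / ‖k‖ ^ 2 + 1 / k.im ^ 2 + ‖k‖ / k.im ^ 2 + 1 / k.im)) := by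
  set X := c ^ 2 * N ^ 2 * (1 / ‖k‖ ^ 2 + 1 / k.im ^ 2 + ‖k‖ / k.im ^ 2 + 1 / k.im) with hX
  have hk := h.hk
  have hX0 : 0 ≤ X := by positivity
  obtain ⟨B, hB⟩ := hb
  set S := sSup (m '' Set.Ici 0) with hS
  have hbdd : BddAbove (m '' Set.Ici 0) := ⟨B, by rintro _ ⟨r, hr, rfl⟩; exact hB r hr⟩
  have hle : ∀ r, 0 ≤ r → m r ≤ S := fun r hr => le_csSup hbdd ⟨r, hr, rfl⟩
  have hS0 : 0 ≤ S := (h.m0 0).trans (hle 0 le_rfl)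
  rcases hS0.eq_or_lt with h0 | h0
  · have := hle R hR
    linarith
  have hM : 0 < √S := Real.sqrt_pos.2 h0
  have h3 := fun R (hR : 0 < R) => h.step3 hM (fun r hr => by rw [Real.sq_sqrt hS0]; exact hle r hr) hR
  rw [Real.sq_sqrt hS0, ← hX] at h3
  have h4 : S ≤ S / 2 + 400000 * X := by
    refine csSup_le ⟨_, ⟨0, Set.self_mem_Ici, rfl⟩⟩ ?_
    rintro _ ⟨r, hr, rfl⟩
    rcases (show (0:ℝ) ≤ r from hr).eq_or_lt with h5 | h5
    · rw [← h5, h.mz]; positivity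
    · exact h3 r h5
  have := hle R hR
  linarith
end OneD

lemma wcont_gen {n : ℝ → ℝ} (nc : Continuous n) (nz : ∃ ρ : ℝ, 0 < ρ ∧ ∀ r, |r| < ρ → n r = 0) :
    Continuous fun r => n r * (max 1 r / r) ^ 2 := by
  obtain ⟨ρ, hρ, hz⟩ := nz
  rw [continuous_iff_continuousAt]
  intro r
  by_cases hr : r = 0
  · subst hr
    have : (fun r => n r * (max 1 r / r) ^ 2) =ᶠ[nhds 0] fun _ => 0 := by
      have h1 : ∀ᶠ r : ℝ in nhds 0, |r| < ρ := by
        have := Metric.ball_mem_nhds (0 : ℝ) hρ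
        filter_upwards [this] with r hr
        simpa using hr
      filter_upwards [h1] with r hr
      simp [hz r hr]
    exact continuousAt_const.congr this.symm
  · have h2 : ContinuousAt (fun r : ℝ => max 1 r / r) r :=
      ContinuousAt.div (by fun_prop) continuousAt_id hr
    exact nc.continuousAt.mul (h2.pow 2)

section
variable {k : ℂ} {f : E3 → EuclideanSpace ℂ (Fin 3)}

lemma f_near (h0 : (0 : E3) ∉ tsupport f) : ∃ ρ : ℝ, 0 < ρ ∧ ∀ x, ‖x‖ < ρ → f x = 0 := by
  have : f =ᶠ[nhds 0] 0 := notMem_tsupport_iff_eventuallyEq.mp h0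
  obtain ⟨ρ, hρ, h⟩ := Metric.eventually_nhds_iff.1 this
  exact ⟨ρ, hρ, fun x hx => h (by simpa using hx)⟩

lemma f_far (hs : HasCompactSupport f) : ∃ R : ℝ, 0 < R ∧ ∀ x, R < ‖x‖ → f x = 0 := by
  obtain ⟨R, hR⟩ := hs.isCompact.isBounded.subset_closedBall 0
  refine ⟨max R 1, by positivity, fun x hx => ?_⟩
  by_contra hne
  have := hR (subset_tsupport f hne)
  simp at this
  have := le_max_left R 1
  linarith

lemma wt_smul {r : ℝ} (hr : 0 < r) (σ : sphere (0 : E3) 1) : wt (r • (σ : E3)) = (max 1 r / r) ^ 2 := by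
  unfold wt
  rw [norm_sph hr σ]
  split_ifs with h
  · rw [max_eq_right h.le, div_self hr.ne']; norm_num
  · rw [max_eq_left (not_lt.1 h)]; simp

lemma wt_nonneg (x : E3) : 0 ≤ wt x := by
  unfold wt; split_ifs <;> positivity

lemma wt_meas : Measurable wt := by
  unfold wt
  refine Measurable.ite (measurableSet_lt measurable_const measurable_norm) measurable_const ?_
  fun_prop

lemma fw_integrable (hf : ContDiff ℝ (⊤ : ℕ∞) f) (hs : HasCompactSupport f) (h0 : (0 : E3) ∉ tsupport f) :
    Integrable fun y => ‖f y‖ ^ 2 * wt y := by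
  obtain ⟨ρ, hρ, hz⟩ := f_near h0
  have h1 : Integrable fun y => ‖f y‖ ^ 2 := by
    refine Continuous.integrable_of_hasCompactSupport (hf.continuous.norm.pow 2) ?_
    exact hs.comp_left (g := fun v => ‖v‖ ^ 2) (by simp)
  refine Integrable.mono (h1.const_mul (1 + (ρ ^ 2)⁻¹)) ?_ (Filter.Eventually.of_forall fun y => ?_)
  · exact (hf.continuous.norm.pow 2).aestronglyMeasurable.mul wt_meas.aestronglyMeasurable
  · have hw := wt_nonneg y
    rw [Real.norm_of_nonneg (by positivity), Real.norm_of_nonneg (by positivity), mul_comm]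
    by_cases hy : ‖y‖ < ρ
    · simp [hz y hy]
    · refine mul_le_mul_of_nonneg_right ?_ (by positivity)
      push Not at hy
      unfold wt
      have h3 : (‖y‖ ^ 2)⁻¹ ≤ (ρ ^ 2)⁻¹ := by gcongr
      have h4 : 0 ≤ (ρ ^ 2)⁻¹ := by positivity
      split_ifs <;> linarith

lemma fE_norm {r : ℝ} (hr : 0 < r) (σ : sphere (0 : E3) 1) :
    n3 (fun i => fE k (Fv k f) i r σ) ^ 2 = ‖f (r • (σ : E3))‖ ^ 2 := by
  rw [n3_sq, EuclideanSpace.norm_sq_eq]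
  refine Finset.sum_congr rfl fun i _ => ?_
  unfold fE Fv En
  rw [norm_sph hr σ, ← mul_assoc, ← Complex.exp_add]
  simp

lemma nQ_eq {r : ℝ} (hr : 0 < r) : nQ k (Fv k f) r * (max 1 r / r) ^ 2 =
    r ^ 2 • ∫ σ : sphere (0 : E3) 1, ‖f (r • (σ : E3))‖ ^ 2 * wt (r • (σ : E3)) ∂SS := by
  unfold nQ
  simp only [wt_smul hr, fE_norm hr]
  rw [integral_mul_const, smul_eq_mul, mul_assoc]

lemma nQ_near (h0 : (0 : E3) ∉ tsupport f) : ∃ ρ : ℝ, 0 < ρ ∧ ∀ r, |r| < ρ → nQ k (Fv k f) r = 0 := by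
  obtain ⟨ρ, hρ, hz⟩ := f_near h0
  refine ⟨ρ, hρ, fun r hr => ?_⟩
  unfold nQ
  have : ∀ σ : sphere (0 : E3) 1, n3 (fun i => fE k (Fv k f) i r σ) ^ 2 = 0 := by
    intro σ
    rw [n3_sq]
    have : f (r • (σ : E3)) = 0 := hz _ (by rw [norm_smul]; simpa using hr)
    simp [fE, Fv, this]
  simp [this]

lemma nQ_far (hs : HasCompactSupport f) : ∃ R : ℝ, 0 < R ∧ ∀ r, R < r → nQ k (Fv k f) r = 0 := by
  obtain ⟨R, hR, hz⟩ := f_far hs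
  refine ⟨R, hR, fun r hr => ?_⟩
  unfold nQ
  have : ∀ σ : sphere (0 : E3) 1, n3 (fun i => fE k (Fv k f) i r σ) ^ 2 = 0 := by
    intro σ
    rw [fE_norm (by linarith), hz _ (by rw [norm_sph (by linarith) σ]; exact hr)]
    simp
  simp [this]

lemma uu_oneD (hk : 0 < k.im) (hf : ContDiff ℝ (⊤ : ℕ∞) f) (hs : HasCompactSupport f)
    (h0 : (0 : E3) ∉ tsupport f) :
    OneD k cS (√(∫ y, ‖f y‖ ^ 2 * wt y)) (mQ k (uu k f)) (eQ k (uu k f)) (nQ k (Fv k f))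
      (pQ k (uu k f)) (qQ k (uu k f) (Fv k f)) (sQ k (uu k f) (Fv k f)) := by
  have hu := uu_contDiff hk hf hs h0
  have hu2 : ContDiff ℝ 2 (uu k f) := hu.of_le two_le_sm
  have hu1 : ContDiff ℝ 1 (uu k f) := hu2.of_le (by norm_num)
  have hF := fun i => Fv_contDiff (k := k) hf h0 i
  have hF1 : ∀ i, ContDiff ℝ 1 (Fv k f i) := fun i => ((hF i).of_le two_le_sm).of_le (by norm_num)
  have hFc := fun i => (hF i).continuous
  exact
  { hk := hk
    hc := cS_nonneg
    hN := Real.sqrt_nonneg _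
    mc := mQ_cont hu1
    ec := eQ_cont hu1
    nc := nQ_cont hFc
    pc := pQ_cont hu1
    qc := qQ_cont hu1 hFc
    sc := sQ_cont hu1 hFc
    m0 := fun r => mQ_nonneg ..
    e0 := fun r => eQ_nonneg ..
    n0 := fun r => nQ_nonneg ..
    mz := by simp [mQ, Mu]
    dm := fun r => mQ_hasDerivAt hu1 r
    dpq := fun r hr => pq_hasDerivAt hu2 hF1 (fun x => uu_pde hk hf hs h0 x) hr
    bp := fun r _ => pQ_le hu1 r
    bq := fun r hr => qQ_le hu1 hFc hr
    bs := fun r hr => sQ_le hu1 hFc hr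
    nz := nQ_near h0
    nR := nQ_far hs
    nN := by
      intro R hR
      have hIntg := fw_integrable hf hs h0
      rw [Real.sq_sqrt (integral_nonneg fun y => by have := wt_nonneg y; positivity), polar _ hIntg]
      have hcont : Continuous fun r => nQ k (Fv k f) r * (max 1 r / r) ^ 2 :=
        wcont_gen (nQ_cont hFc) (nQ_near h0)
      have e1 : ∫ r in Set.Ioi (0:ℝ), (r ^ 2 : ℝ) •
            ∫ σ : sphere (0 : E3) 1, ‖f (r • (σ : E3))‖ ^ 2 * wt (r • (σ : E3)) ∂SS
          = ∫ r in Set.Ioi (0:ℝ), nQ k (Fv k f) r * (max 1 r / r) ^ 2 :=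
        setIntegral_congr_fun measurableSet_Ioi fun r hr => (nQ_eq hr).symm
      rw [e1, intervalIntegral.integral_of_le hR.le]
      refine setIntegral_mono_set ?_ ?_ (Filter.Eventually.of_forall fun r hr => hr.1)
      · obtain ⟨R1, hR1, hz⟩ := nQ_far (k := k) hs
        rw [← Set.Ioc_union_Ioi_eq_Ioi hR1.le]
        refine IntegrableOn.union hcont.integrableOn_Ioc ?_
        refine (integrableOn_zero).congr_fun (fun r hr => ?_) measurableSet_Ioi
        simp [hz r hr]
      · exact Filter.Eventually.of_forall fun r =>
          mul_nonneg (nQ_nonneg ..) (sq_nonneg _) }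

lemma mQ_bdd (hk : 0 < k.im) (hf : ContDiff ℝ (⊤ : ℕ∞) f) (hs : HasCompactSupport f)
    (h0 : (0 : E3) ∉ tsupport f) : ∃ B, ∀ r, 0 ≤ r → mQ k (uu k f) r ≤ B := by
  have hu := uu_contDiff hk hf hs h0
  have hu1 : ContDiff ℝ 1 (uu k f) := (hu.of_le two_le_sm).of_le (by norm_num)
  obtain ⟨C, R, hR, hC⟩ := uu_decay hk hf hs h0
  obtain ⟨B, hB⟩ := (isCompact_Icc (a := (0:ℝ)) (b := R)).exists_bound_of_continuousOn
    (mQ_cont (k := k) hu1).continuousOn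
  refine ⟨max B (∫ _ : sphere (0 : E3) 1, C ^ 2 ∂SS), fun r hr => ?_⟩
  rcases le_total r R with h | h
  · exact ((le_abs_self _).trans (hB r ⟨hr, h⟩)).trans (le_max_left _ _)
  · refine le_trans ?_ (le_max_right _ _)
    refine integral_mono (integrable_sph (((slice (Mu_cont hu1) r).norm.pow 2))) (integrable_const _) fun σ => ?_
    have hr0 : 0 < r := hR.trans_le h
    have h1 := hC (r • (σ : E3)) (by rw [norm_sph hr0]; exact h)
    rw [norm_sph hr0] at h1
    have h2 : ‖Mu k (uu k f) r σ‖ = r * Real.exp (k.im * r) * ‖uu k f (r • (σ : E3))‖ := by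
      unfold Mu En
      rw [norm_mul, norm_mul, Complex.norm_exp]
      simp [abs_of_pos hr0]
    simp only [h2]
    gcongr

lemma mQ_bound (hk : 0 < k.im) (hf : ContDiff ℝ (⊤ : ℕ∞) f) (hs : HasCompactSupport f)
    (h0 : (0 : E3) ∉ tsupport f) {r : ℝ} (hr : 0 ≤ r) :
    mQ k (uu k f) r ≤ 800000 * (cS ^ 2 * (∫ y, ‖f y‖ ^ 2 * wt y) *
      (1 / ‖k‖ ^ 2 + 1 / k.im ^ 2 + ‖k‖ / k.im ^ 2 + 1 / k.im)) := by
  have := (uu_oneD hk hf hs h0).step4 (mQ_bdd hk hf hs h0) hr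
  rwa [Real.sq_sqrt (integral_nonneg fun y => by have := wt_nonneg y; positivity)] at this
end

section Haus
open scoped Pointwise

/-- The point of height `s` in direction `i` over `q`. -/
noncomputable def gv (i : Fin 3) (s : ℝ) (q : Fin 2 → ℝ) : E3 :=
  WithLp.toLp 2 (i.insertNth (α := fun _ => ℝ) s q)

/-- Inverse gnomonic projection. -/
noncomputable def gL (i : Fin 3) (s : ℝ) (q : Fin 2 → ℝ) : E3 := ‖gv i s q‖⁻¹ • gv i s q

/-- splitting of coordinates -/
noncomputable def gP (i : Fin 3) (x : E3) : ℝ × (Fin 2 → ℝ) := (x i, fun j => x (i.succAbove j))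

lemma gP_mp (i : Fin 3) : MeasurePreserving (gP i) volume volume := by
  have h1 := (PiLp.volume_preserving_ofLp (Fin 3))
  have h2 := (volume_preserving_piFinSuccAbove (fun _ : Fin 3 => ℝ) i)
  exact h2.comp h1

lemma gv_same (i : Fin 3) (s : ℝ) (q : Fin 2 → ℝ) : gv i s q i = s := by simp [gv]
lemma gv_succ (i : Fin 3) (s : ℝ) (q : Fin 2 → ℝ) (j : Fin 2) : gv i s q (i.succAbove j) = q j := by
  simp [gv]

lemma gext (i : Fin 3) {x y : E3} (h1 : x i = y i) (h2 : ∀ j, x (i.succAbove j) = y (i.succAbove j)) : x = y := by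
  ext l
  rcases Fin.eq_self_or_eq_succAbove i l with h | ⟨j, h⟩
  · rw [h]; exact h1
  · rw [h]; exact h2 j

lemma norm_sq_split (i : Fin 3) (x : E3) : ‖x‖ ^ 2 = x i ^ 2 + ∑ j, x (i.succAbove j) ^ 2 := by
  rw [EuclideanSpace.norm_sq_eq, Fin.sum_univ_succAbove _ i]
  simp

lemma gv_norm_ge (i : Fin 3) {s : ℝ} (hs : s ^ 2 = 1) (q : Fin 2 → ℝ) : 1 ≤ ‖gv i s q‖ := by
  have h := norm_sq_split i (gv i s q)
  rw [gv_same, hs] at h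
  have : 0 ≤ ∑ j, gv i s q (i.succAbove j) ^ 2 := Finset.sum_nonneg fun j _ => sq_nonneg _
  nlinarith [norm_nonneg (gv i s q)]

lemma gv_lip (i : Fin 3) (s : ℝ) (q q' : Fin 2 → ℝ) : ‖gv i s q - gv i s q'‖ ≤ 2 * ‖q - q'‖ := by
  have h := norm_sq_split i (gv i s q - gv i s q')
  have h1 : ∑ j, (gv i s q - gv i s q') (i.succAbove j) ^ 2 ≤ ∑ j : Fin 2, ‖q - q'‖ ^ 2 := by
    refine Finset.sum_le_sum fun j _ => ?_
    rw [PiLp.sub_apply, gv_succ, gv_succ]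
    have := norm_le_pi_norm (q - q') j
    rw [Pi.sub_apply, Real.norm_eq_abs] at this
    rw [← sq_abs]
    gcongr
  rw [PiLp.sub_apply, gv_same, gv_same] at h
  rw [Finset.sum_const] at h1
  simp only [Finset.card_univ, Fintype.card_fin, nsmul_eq_mul, Nat.cast_ofNat] at h1
  refine abs_le_of_sq_le_sq' ?_ (by positivity) |>.2
  nlinarith [norm_nonneg (q - q')]

lemma normalize_lip {v w : E3} (hv : 1 ≤ ‖v‖) (hw : 1 ≤ ‖w‖) : ‖‖v‖⁻¹ • v - ‖w‖⁻¹ • w‖ ≤ 2 * ‖v - w‖ := by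
  have hv0 : 0 < ‖v‖ := by linarith
  have hw0 : 0 < ‖w‖ := by linarith
  have e : ‖v‖⁻¹ • v - ‖w‖⁻¹ • w = ‖v‖⁻¹ • (v - w) + (‖v‖⁻¹ - ‖w‖⁻¹) • w := by
    rw [smul_sub, sub_smul]; abel
  rw [e]
  refine (norm_add_le _ _).trans ?_
  rw [norm_smul, norm_smul, norm_inv, norm_norm, Real.norm_eq_abs]
  have h1 : ‖v‖⁻¹ ≤ 1 := inv_le_one_of_one_le₀ hv
  have h2 : |‖v‖⁻¹ - ‖w‖⁻¹| * ‖w‖ = ‖v‖⁻¹ * |‖w‖ - ‖v‖| := by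
    have : ‖v‖⁻¹ - ‖w‖⁻¹ = ‖v‖⁻¹ * (‖w‖ - ‖v‖) * ‖w‖⁻¹ := by field_simp
    rw [this, abs_mul, abs_mul, abs_of_pos (inv_pos.2 hv0), abs_of_pos (inv_pos.2 hw0)]
    field_simp
  have h3 : |‖w‖ - ‖v‖| ≤ ‖v - w‖ := by rw [norm_sub_rev]; exact abs_norm_sub_norm_le w v
  rw [h2]
  have := norm_nonneg (v - w)
  have h4 : ‖v‖⁻¹ * ‖v - w‖ ≤ 1 * ‖v - w‖ := by gcongr
  have h5 : ‖v‖⁻¹ * |‖w‖ - ‖v‖| ≤ 1 * ‖v - w‖ := by gcongr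
  linarith

lemma gL_lip (i : Fin 3) {s : ℝ} (hs : s ^ 2 = 1) : LipschitzWith 4 (gL i s) := by
  refine LipschitzWith.of_dist_le_mul fun q q' => ?_
  rw [dist_eq_norm, dist_eq_norm]
  refine (normalize_lip (gv_norm_ge i hs q) (gv_norm_ge i hs q')).trans ?_
  have := gv_lip i s q q'
  simp; linarith

/-- The parameter set. -/
def gQ (i : Fin 3) (s : ℝ) (A : Set E3) : Set (Fin 2 → ℝ) := {q | gL i s q ∈ A ∧ ∀ j, |q j| ≤ 1}

lemma gQ_meas (i : Fin 3) {s : ℝ} (hs : s ^ 2 = 1) {A : Set E3} (hA : MeasurableSet A) :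
    MeasurableSet (gQ i s A) := by
  have h1 : MeasurableSet {q : Fin 2 → ℝ | gL i s q ∈ A} := (gL_lip i hs).continuous.measurable hA
  have h2 : MeasurableSet {q : Fin 2 → ℝ | ∀ j, |q j| ≤ 1} := by
    rw [Set.ofPred_forall]
    exact MeasurableSet.iInter fun j => measurableSet_le (by fun_prop) measurable_const
  exact h1.inter h2

lemma cover (A : Set E3) : A ∩ sphere 0 1 ⊆
    ⋃ i : Fin 3, (gL i 1 '' gQ i 1 A ∪ gL i (-1) '' gQ i (-1) A) := by
  rintro x ⟨hxA, hx⟩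
  have hx1 : ‖x‖ = 1 := by simpa using hx
  obtain ⟨i, -, hi⟩ := Finset.exists_max_image Finset.univ (fun i : Fin 3 => |x i|) Finset.univ_nonempty
  have hpos : 0 < |x i| := by
    by_contra! hle
    have : x = 0 := by
      ext j
      have h1 := hi j (Finset.mem_univ _)
      have : |x j| ≤ 0 := h1.trans hle
      simpa using this
    rw [this] at hx1; simp at hx1
  have key : ∀ s : ℝ, s ^ 2 = 1 → s * x i = |x i| → x ∈ gL i s '' gQ i s A := by
    intro s hs hsx
    set q : Fin 2 → ℝ := fun j => |x i|⁻¹ * x (i.succAbove j) with hq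
    have hv : gv i s q = |x i|⁻¹ • x := by
      refine gext i ?_ fun j => ?_
      · rw [gv_same, PiLp.smul_apply, smul_eq_mul, eq_inv_mul_iff_mul_eq₀ hpos.ne', ← hsx]
        linear_combination (x i) * hs
      · rw [gv_succ, PiLp.smul_apply, smul_eq_mul]
    have hL : gL i s q = x := by
      unfold gL
      rw [hv, norm_smul, hx1, smul_smul, norm_inv, Real.norm_eq_abs, abs_abs, mul_one, inv_inv,
        mul_inv_cancel₀ hpos.ne', one_smul]
    refine ⟨q, ⟨by rw [hL]; exact hxA, fun j => ?_⟩, hL⟩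
    rw [hq, abs_mul, abs_inv, abs_abs, inv_mul_le_iff₀ hpos, mul_one]
    exact hi _ (Finset.mem_univ _)
  refine Set.mem_iUnion.2 ⟨i, ?_⟩
  rcases le_total 0 (x i) with h | h
  · exact Or.inl (key 1 (by norm_num) (by rw [abs_of_nonneg h, one_mul]))
  · exact Or.inr (key (-1) (by norm_num) (by rw [abs_of_nonpos h]; ring))

lemma gQ_vol (i : Fin 3) {s : ℝ} (hs : s ^ 2 = 1) {A : Set E3} (hA : MeasurableSet A) :
    volume (gQ i s A) ≤ 64 * volume (Set.Ioo (0 : ℝ) 1 • (A ∩ sphere (0 : E3) 1)) := by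
  have hQ := gQ_meas i hs hA
  set S : Set (ℝ × (Fin 2 → ℝ)) := {z | s * z.1 ∈ Set.Ioo (1/4 : ℝ) (1/2) ∧ (s * z.1)⁻¹ • z.2 ∈ gQ i s A} with hS
  have hSm : MeasurableSet S := by
    have h1 : Measurable fun z : ℝ × (Fin 2 → ℝ) => s * z.1 := by fun_prop
    have h2 : Measurable fun z : ℝ × (Fin 2 → ℝ) => (s * z.1)⁻¹ • z.2 := by fun_prop
    exact (h1 measurableSet_Ioo).inter (h2 hQ)
  have hT : gP i ⁻¹' S ⊆ Set.Ioo (0 : ℝ) 1 • (A ∩ sphere (0 : E3) 1) := by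
    rintro x ⟨⟨hx1, hx2⟩, hq, hqb⟩
    simp only [gP] at hx1 hx2 hq hqb
    set h := s * x i with hh
    have hh0 : 0 < h := by linarith
    set q := h⁻¹ • fun j => x (i.succAbove j) with hqd
    have hv : x = h • gv i s q := by
      refine gext i ?_ fun j => ?_
      · rw [PiLp.smul_apply, gv_same, smul_eq_mul, hh]
        linear_combination -(x i) * hs
      · rw [PiLp.smul_apply, gv_succ, hqd]
        simp [hh0.ne']
    have hge := gv_norm_ge i hs q
    have hlt : ‖gv i s q‖ < 2 := by
      have h1 := norm_sq_split i (gv i s q)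
      rw [gv_same, hs] at h1
      have h2 : ∑ j, gv i s q (i.succAbove j) ^ 2 ≤ ∑ j : Fin 2, (1 : ℝ) := by
        refine Finset.sum_le_sum fun j _ => ?_
        rw [gv_succ, ← sq_abs]
        have := hqb j
        have h0 := abs_nonneg (q j)
        nlinarith
      rw [Finset.sum_const] at h2
      simp only [Finset.card_univ, Fintype.card_fin, nsmul_eq_mul, Nat.cast_ofNat] at h2
      nlinarith
    have hL1 : ‖gL i s q‖ = 1 := by
      unfold gL
      rw [norm_smul, norm_inv, norm_norm, inv_mul_cancel₀ (by linarith)]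
    refine Set.mem_smul.2 ⟨h * ‖gv i s q‖, ⟨by positivity, by nlinarith⟩, gL i s q, ⟨hq, by simpa using hL1⟩, ?_⟩
    unfold gL
    rw [smul_smul, mul_assoc, mul_inv_cancel₀ (by linarith), mul_one, ← hv]
  have hvT : volume S ≤ volume (Set.Ioo (0 : ℝ) 1 • (A ∩ sphere (0 : E3) 1)) := by
    rw [← (gP_mp i).measure_preimage hSm.nullMeasurableSet]
    exact measure_mono hT
  have hI : volume {t : ℝ | s * t ∈ Set.Ioo (1/4 : ℝ) (1/2)} = 1 / 4 := by
    have hs0 : s ≠ 0 := by rintro rfl; norm_num at hs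
    have habs : |s| = 1 := by
      rw [← abs_one, ← sq_eq_sq_iff_abs_eq_abs]; simpa using hs
    have : {t : ℝ | s * t ∈ Set.Ioo (1/4 : ℝ) (1/2)} = (s * ·) ⁻¹' Set.Ioo (1/4 : ℝ) (1/2) := rfl
    rw [this, Real.volume_preimage_mul_left hs0, abs_inv, habs, Real.volume_Ioo]
    norm_num
    rw [ENNReal.ofReal_div_of_pos (by norm_num)]
    norm_num
  have hlow : (1 / 16 : ENNReal) * volume (gQ i s A) * (1 / 4) ≤ volume S := by
    rw [Measure.volume_eq_prod, Measure.prod_apply hSm, ← hI, ← setLIntegral_const]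
    have hIm : MeasurableSet {t : ℝ | s * t ∈ Set.Ioo (1/4 : ℝ) (1/2)} :=
      (by fun_prop : Measurable fun t : ℝ => s * t) measurableSet_Ioo
    refine le_trans (setLIntegral_mono' hIm fun t ht => ?_) (setLIntegral_le_lintegral _ _)
    have ht0 : 0 < s * t := by linarith [ht.1]
    have : Prod.mk t ⁻¹' S = ((s * t)⁻¹ • ·) ⁻¹' gQ i s A := by
      ext y
      exact ⟨fun h => h.2, fun h => ⟨ht, h⟩⟩
    rw [this, Measure.addHaar_preimage_smul _ (by positivity)]
    gcongr
    have h1 : (1 / 16 : ENNReal) = ENNReal.ofReal (1 / 16) := by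
      rw [ENNReal.ofReal_div_of_pos (by norm_num)]; norm_num
    rw [h1]
    apply ENNReal.ofReal_le_ofReal
    have h14 := ht.1
    rw [Module.finrank_fin_fun, inv_pow, inv_inv, abs_of_pos (by positivity)]
    nlinarith
  calc volume (gQ i s A) = 64 * ((1 / 16 : ENNReal) * volume (gQ i s A) * (1 / 4)) := by
        rw [mul_right_comm, ← mul_assoc]
        have : (64 : ENNReal) * (1 / 16 * (1 / 4)) = 1 := by
          have e1 : (1 / 16 : ENNReal) * (1 / 4) = 64⁻¹ := by
            rw [one_div, one_div, ← ENNReal.mul_inv (by norm_num) (by norm_num)]; norm_num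
          rw [e1, ENNReal.mul_inv_cancel (by norm_num) (by norm_num)]
        rw [this, one_mul]
    _ ≤ _ := by gcongr; exact hlow.trans hvT

lemma haus_image (i : Fin 3) {s : ℝ} (hs : s ^ 2 = 1) {A : Set E3} (hA : MeasurableSet A) :
    μH[2] (gL i s '' gQ i s A) ≤ 1024 * volume (Set.Ioo (0 : ℝ) 1 • (A ∩ sphere (0 : E3) 1)) := by
  have h1 := (gL_lip i hs).hausdorffMeasure_image_le (d := 2) (by norm_num) (gQ i s A)
  have h2 : (μH[2] : Measure (Fin 2 → ℝ)) = volume := by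
    have := hausdorffMeasure_pi_real (ι := Fin 2)
    simpa using this
  rw [h2] at h1
  refine h1.trans ?_
  calc _ ≤ ((4 : NNReal) : ENNReal) ^ (2 : ℝ) * (64 * volume (Set.Ioo (0 : ℝ) 1 • (A ∩ sphere (0 : E3) 1))) := by
        gcongr; exact gQ_vol i hs hA
    _ = _ := by
        rw [← mul_assoc]
        congr 1
        rw [ENNReal.rpow_two]
        norm_num

lemma haus_le : (μH[2] : Measure E3).restrict (sphere 0 1) ≤ (2048 : ENNReal) • (SS.map Subtype.val) := by
  refine Measure.le_iff.2 fun A hA => ?_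
  rw [Measure.restrict_apply hA, Measure.smul_apply, Measure.map_apply measurable_subtype_coe hA,
    Measure.toSphere_apply' _ (measurable_subtype_coe hA)]
  have e : (Subtype.val '' (Subtype.val ⁻¹' A : Set (sphere (0 : E3) 1))) = A ∩ sphere 0 1 := by
    rw [Subtype.image_preimage_coe, Set.inter_comm]
  rw [e]
  refine (measure_mono (cover A)).trans ((measure_iUnion_le _).trans ?_)
  rw [tsum_fintype]
  have : ∀ i : Fin 3, μH[2] (gL i 1 '' gQ i 1 A ∪ gL i (-1) '' gQ i (-1) A) ≤
      2048 * volume (Set.Ioo (0 : ℝ) 1 • (A ∩ sphere (0 : E3) 1)) := by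
    intro i
    refine (measure_union_le _ _).trans ?_
    refine (add_le_add (haus_image i (by norm_num) hA) (haus_image i (by norm_num) hA)).trans ?_
    rw [← add_mul]; norm_num
  refine (Finset.sum_le_sum fun i _ => this i).trans ?_
  simp
  rw [← mul_assoc, ← mul_assoc, mul_comm (3 : ENNReal)]

lemma haus_int {g : E3 → ℝ} (hg : Continuous g) (h0 : ∀ x, 0 ≤ g x) :
    ∫ x in sphere (0 : E3) 1, g x ∂μH[2] ≤ 2048 * ∫ σ : sphere (0 : E3) 1, g σ ∂SS := by
  have hi : Integrable g (SS.map Subtype.val) := by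
    rw [integrable_map_measure hg.aestronglyMeasurable measurable_subtype_coe.aemeasurable]
    exact integrable_sph hg
  have := integral_mono_measure haus_le (Filter.Eventually.of_forall fun x => h0 x)
    (hi.smul_measure (by norm_num))
  rw [integral_smul_measure, integral_map measurable_subtype_coe.aemeasurable hg.aestronglyMeasurable] at this
  simpa using this

end Haus

/-- Uniform-in-`r` bound for `‖μ₄(r,·)‖_{L²(S²)}` in terms of the
weighted norm `‖f‖_{2,w}`, for `k ∈ ℂ⁺` and `f ∈ C_c^∞(ℝ³∖{0}; ℂ³)`. -/
theorem stmt_7 :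
    ∃ C : ℝ, 0 < C ∧
      ∀ k : ℂ, 0 < k.im →
        ∀ f : EuclideanSpace ℝ (Fin 3) → EuclideanSpace ℂ (Fin 3),
          ContDiff ℝ (⊤ : ℕ∞) f → HasCompactSupport f →
          (0 : EuclideanSpace ℝ (Fin 3)) ∉ tsupport f →
          ∀ r : ℝ, 0 < r →
            Real.sqrt (∫ σ in sphere (0 : EuclideanSpace ℝ (Fin 3)) 1,
                ‖mu4 k f r σ‖ ^ 2 ∂μH[2]) ≤
              C * (Real.sqrt (1 / ‖k‖ ^ 2 + 1 / k.im ^ 2 + ‖k‖ / k.im ^ ((3 : ℝ) / 2)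
                      + ‖k‖ / k.im ^ 2 + 1 / k.im)
                  + Real.sqrt (1 / ‖k‖ ^ 2 + 1 / (‖k‖ ^ 2 * k.im ^ 2)
                      + 1 / (‖k‖ * Real.sqrt k.im) + 1 / (‖k‖ * k.im ^ 2))) *
                Real.sqrt (∫ y : EuclideanSpace ℝ (Fin 3), ‖f y‖ ^ 2 * wt y) := by
  refine ⟨√(2048 * 800000 * (cS ^ 2 + 1)), by positivity, fun k hk f hf hs h0 r hr => ?_⟩
  have hu := uu_contDiff hk hf hs h0
  have hu1 : ContDiff ℝ 1 (uu k f) := (hu.of_le two_le_sm).of_le (by norm_num)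
  have hmu : ∀ x, mu4 k f r x = Mu k (uu k f) r x := fun x => mu4_eq hk hf hs h0 r x
  have h1 : ∫ σ in sphere (0 : E3) 1, ‖mu4 k f r σ‖ ^ 2 ∂μH[2] ≤ 2048 * mQ k (uu k f) r := by
    simp only [hmu]
    exact haus_int ((slice (Mu_cont hu1) r).norm.pow 2) fun x => by positivity
  have h2 := mQ_bound hk hf hs h0 hr.le
  have hI : 0 ≤ ∫ y, ‖f y‖ ^ 2 * wt y := integral_nonneg fun y => by have := wt_nonneg y; positivity
  set I := ∫ y, ‖f y‖ ^ 2 * wt y with hIdef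
  set D1 := 1 / ‖k‖ ^ 2 + 1 / k.im ^ 2 + ‖k‖ / k.im ^ ((3 : ℝ) / 2) + ‖k‖ / k.im ^ 2 + 1 / k.im with hD1
  have hD : 1 / ‖k‖ ^ 2 + 1 / k.im ^ 2 + ‖k‖ / k.im ^ 2 + 1 / k.im ≤ D1 := by
    have : 0 ≤ ‖k‖ / k.im ^ ((3 : ℝ) / 2) := by positivity
    rw [hD1]; linarith
  have hD0 : 0 ≤ D1 := by positivity
  have h3 : ∫ σ in sphere (0 : E3) 1, ‖mu4 k f r σ‖ ^ 2 ∂μH[2] ≤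
      2048 * 800000 * (cS ^ 2 + 1) * D1 * I := by
    have : cS ^ 2 * I * (1 / ‖k‖ ^ 2 + 1 / k.im ^ 2 + ‖k‖ / k.im ^ 2 + 1 / k.im) ≤ (cS ^ 2 + 1) * I * D1 := by
      gcongr
      linarith
    linarith
  refine (Real.sqrt_le_sqrt h3).trans ?_
  rw [Real.sqrt_mul (by positivity), Real.sqrt_mul (by positivity)]
  gcongr
  exact le_add_of_nonneg_right (Real.sqrt_nonneg _)
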